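/- A sequence (d_1, d_2, d_3, d_4) of four positive integers is the degree sequence of a hsop of I_6 (the ring of invariants of the binary sextic) if and only if: no d_i lies in {1, 3, 5, 7, 9, 11, 13}; at most one of the d_i lies in {2, 17}; at most two of the d_i lie in {2, 4, 8, 14, 17, 19, 23, 29}; at most two of the d_i lie in {2, 6, 17, 21}; at least three of the d_i are divisible by 2; at least one is divisible by 3; at least one is divisible by 4; and at least one is divisible by 5. -/

import Mathlib

set_option synthInstance.maxHeartbeats 1000000
noncomputable section

open MvPolynomial

/-- The binary form of degree `n` with coefficient vector `a`, as a polynomial in two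
variables `X 0 = x`, `X 1 = y`. -/
def formPoly (n : ℕ) (a : Fin (n+1) → ℂ) : MvPolynomial (Fin 2) ℂ :=
  ∑ i : Fin (n+1), C (a i) * X 0 ^ (n - (i : ℕ)) * X 1 ^ (i : ℕ)

/-- The action of `SL(2,ℂ)` on coefficient vectors of binary forms of degree `n`,
given by linear substitution of the variables `x`, `y`. -/
def sl2Act (n : ℕ) (g : Matrix.SpecialLinearGroup (Fin 2) ℂ) (a : Fin (n+1) → ℂ) :
    Fin (n+1) → ℂ := fun i =>
  coeff (Finsupp.single 0 (n - (i : ℕ)) + Finsupp.single 1 (i : ℕ))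
    (bind₁ (fun j : Fin 2 => C (g.1 j 0) * X 0 + C (g.1 j 1) * X 1) (formPoly n a))

/-- The ring of invariants `I_n` of the binary form of degree `n`: the subalgebra of
`ℂ[a_0,…,a_n]` of polynomials invariant under the `SL(2,ℂ)`-action. -/
def invariantRing (n : ℕ) : Subalgebra ℂ (MvPolynomial (Fin (n+1)) ℂ) where
  carrier := {p | ∀ g : Matrix.SpecialLinearGroup (Fin 2) ℂ, ∀ a : Fin (n+1) → ℂ,
    eval (sl2Act n g a) p = eval a p}
  mul_mem' := by
    intro p q hp hq g a
    simp only [Set.mem_setOf_eq, map_mul] at *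
    rw [hp g a, hq g a]
  add_mem' := by
    intro p q hp hq g a
    simp only [Set.mem_setOf_eq, map_add] at *
    rw [hp g a, hq g a]
  algebraMap_mem' := by
    intro c g a
    simp

/-- `IsHSOP n d p` says that `p` is a homogeneous system of parameters of the invariant
ring of the binary form of degree `n`, with degree sequence `d` : the `p k` are
homogeneous of positive degrees `d k`, algebraically independent over `ℂ`, and `I_n` is a
finitely generated module over the subalgebra they generate. -/
def IsHSOP (n : ℕ) (d : Fin (n-2) → ℕ) (p : Fin (n-2) → invariantRing n) : Prop :=
  (∀ k, 0 < d k) ∧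
  (∀ k, ((p k : MvPolynomial (Fin (n+1)) ℂ)).IsHomogeneous (d k)) ∧
  AlgebraicIndependent ℂ p ∧
  Module.Finite (Algebra.adjoin ℂ (Set.range p)) (invariantRing n)

namespace BinarySextic

section GeneratingFunction

open PowerSeries LaurentPolynomial

/-- The geometric series `∑ cⁿ tⁿ`. -/
def geom {R : Type*} [CommRing R] (c : R) : PowerSeries R := PowerSeries.mk fun n => c ^ n

lemma geom_mul {R : Type*} [CommRing R] (c : R) :
    geom c * (1 - PowerSeries.C c * PowerSeries.X) = 1 := by
  ext n
  rw [mul_sub, mul_one, mul_comm (PowerSeries.C c), ← mul_assoc]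
  cases n with
  | zero => simp [geom]
  | succ n => simp [geom, PowerSeries.coeff_succ_mul_X, PowerSeries.coeff_one, pow_succ]

lemma map_geom {R S : Type*} [CommRing R] [CommRing S] (f : R →+* S) (c : R) :
    PowerSeries.map f (geom c) = geom (f c) := by
  ext n
  simp [geom]

/-- The constant term in the Laurent variable, coefficientwise. -/
def constTerm (s : PowerSeries ℤ[T;T⁻¹]) : PowerSeries ℤ :=
  PowerSeries.mk fun n => (PowerSeries.coeff n s).coeff 0

lemma constTerm_add (s r : PowerSeries ℤ[T;T⁻¹]) :
    constTerm (s + r) = constTerm s + constTerm r := by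
  ext n
  simp [constTerm]

lemma constTerm_map_C_mul (a : PowerSeries ℤ) (s : PowerSeries ℤ[T;T⁻¹]) :
    constTerm (PowerSeries.map (LaurentPolynomial.C : ℤ →+* ℤ[T;T⁻¹]) a * s)
      = a * constTerm s := by
  ext n
  simp only [constTerm, PowerSeries.coeff_mk, PowerSeries.coeff_mul, PowerSeries.coeff_map,
    AddMonoidAlgebra.coeff_sum, Finsupp.coe_finsetSum, Finset.sum_apply]
  refine Finset.sum_congr rfl fun x _ => ?_
  rw [← LaurentPolynomial.smul_eq_C_mul, AddMonoidAlgebra.coeff_smul, Finsupp.smul_apply,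
    smul_eq_mul]

lemma coeff_zero_toLaurent (p : Polynomial ℤ) :
    (Polynomial.toLaurent p).coeff 0 = Polynomial.eval 0 p := by
  induction p using Polynomial.induction_on' with
  | add p q hp hq => simp only [map_add, AddMonoidAlgebra.coeff_add, Finsupp.add_apply, hp, hq,
      Polynomial.eval_add]
  | monomial n a =>
    rw [← Polynomial.C_mul_X_pow_eq_monomial, Polynomial.toLaurent_C_mul_X_pow,
      ← LaurentPolynomial.smul_eq_C_mul]
    rw [AddMonoidAlgebra.coeff_smul, Finsupp.smul_apply, LaurentPolynomial.T_apply]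
    rcases n with _ | n
    · simp
    · simp; omega

lemma constTerm_map_toLaurent (s : PowerSeries (Polynomial ℤ)) :
    constTerm (PowerSeries.map Polynomial.toLaurent s)
      = PowerSeries.map (Polynomial.evalRingHom 0) s := by
  ext n
  simp only [constTerm, PowerSeries.coeff_mk, PowerSeries.coeff_map, coeff_zero_toLaurent]
  rfl

lemma constTerm_map_invert_toLaurent (s : PowerSeries (Polynomial ℤ)) :
    constTerm (PowerSeries.map
        (((LaurentPolynomial.invert : ℤ[T;T⁻¹] ≃ₐ[ℤ] ℤ[T;T⁻¹]) : ℤ[T;T⁻¹] →+* ℤ[T;T⁻¹]).comp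
          Polynomial.toLaurent) s)
      = PowerSeries.map (Polynomial.evalRingHom 0) s := by
  ext n
  simp only [constTerm, PowerSeries.coeff_mk, PowerSeries.coeff_map, RingHom.comp_apply]
  have := coeff_zero_toLaurent (PowerSeries.coeff n s)
  simpa [LaurentPolynomial.invert_apply] using this

/-- The common denominator in the partial fraction decomposition of the generating function. -/
def den {R : Type*} [CommRing R] (t : R) : R :=
  1 + 2 * t + t ^ 2 - t ^ 3 - 3 * t ^ 4 - 4 * t ^ 5 - 3 * t ^ 6 + 3 * t ^ 8 + 4 * t ^ 9
    + 3 * t ^ 10 + t ^ 11 - t ^ 12 - 2 * t ^ 13 - t ^ 14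

/-- The numerator of the part with nonnegative powers of `u`. -/
def numPos {R : Type*} [CommRing R] (t u : R) : R :=
  (1 + t - t ^ 3 - t ^ 4 - t ^ 5 + t ^ 7 + t ^ 8)
    + (-1 - 2 * t - t ^ 2 + t ^ 3 + 2 * t ^ 4 + 2 * t ^ 5 + t ^ 6 - t ^ 7 - 2 * t ^ 8 - t ^ 9) * u
    + (-t ^ 3 - t ^ 4 - t ^ 5) * u ^ 2 + (-t ^ 5 - t ^ 6 - t ^ 7 + t ^ 9 + t ^ 10) * u ^ 3
    + (t ^ 8 + t ^ 9) * u ^ 4 + (t ^ 6 + t ^ 7 + t ^ 8) * u ^ 5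

/-- The numerator of the part with negative powers of `u = v⁻¹`. -/
def numNeg {R : Type*} [CommRing R] (t v : R) : R :=
  v * ((t ^ 3 + t ^ 4 + t ^ 5) + (t ^ 2 + t ^ 3) * v
    + (t + t ^ 2 - t ^ 4 - t ^ 5 - t ^ 6) * v ^ 2 + (-t ^ 6 - t ^ 7 - t ^ 8) * v ^ 3
    + (-t ^ 2 - 2 * t ^ 3 - t ^ 4 + t ^ 5 + 2 * t ^ 6 + 2 * t ^ 7 + t ^ 8 - t ^ 9 - 2 * t ^ 10
      - t ^ 11) * v ^ 4
    + (t ^ 3 + t ^ 4 - t ^ 6 - t ^ 7 - t ^ 8 + t ^ 10 + t ^ 11) * v ^ 5)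

lemma partial_fractions {R : Type*} [CommRing R] (t u v : R) (h : u * v = 1) :
    den t * (1 - u)
      = numPos t u * ((1 - v * t) * (1 - v ^ 2 * t) * (1 - v ^ 3 * t))
        + numNeg t v * ((1 - u * t) * (1 - u ^ 2 * t) * (1 - u ^ 3 * t)) := by
  have h2 : u ^ 2 * v ^ 2 = 1 := by rw [← mul_pow, h, one_pow]
  have h3 : u ^ 3 * v ^ 3 = 1 := by rw [← mul_pow, h, one_pow]
  have h4 : u ^ 4 * v ^ 4 = 1 := by rw [← mul_pow, h, one_pow]
  have h5 : u ^ 5 * v ^ 5 = 1 := by rw [← mul_pow, h, one_pow]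
  have h6 : u ^ 6 * v ^ 6 = 1 := by rw [← mul_pow, h, one_pow]
  have e1 : u ^ 6 * ((1 - v * t) * (1 - v ^ 2 * t) * (1 - v ^ 3 * t))
      = (u - t) * (u ^ 2 - t) * (u ^ 3 - t) := by
    have a1 : u * (1 - v * t) = u - t := by linear_combination (-t) * h
    have a2 : u ^ 2 * (1 - v ^ 2 * t) = u ^ 2 - t := by linear_combination (-t) * h2
    have a3 : u ^ 3 * (1 - v ^ 3 * t) = u ^ 3 - t := by linear_combination (-t) * h3
    rw [← a1, ← a2, ← a3]; ring
  have e2 : u ^ 6 * numNeg t v = (t ^ 3 + t ^ 4 + t ^ 5) * u ^ 5 + (t ^ 2 + t ^ 3) * u ^ 4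
      + (t + t ^ 2 - t ^ 4 - t ^ 5 - t ^ 6) * u ^ 3 + (-t ^ 6 - t ^ 7 - t ^ 8) * u ^ 2
      + (-t ^ 2 - 2 * t ^ 3 - t ^ 4 + t ^ 5 + 2 * t ^ 6 + 2 * t ^ 7 + t ^ 8 - t ^ 9 - 2 * t ^ 10
        - t ^ 11) * u
      + (t ^ 3 + t ^ 4 - t ^ 6 - t ^ 7 - t ^ 8 + t ^ 10 + t ^ 11) := by
    unfold numNeg
    linear_combination (t ^ 3 + t ^ 4 + t ^ 5) * u ^ 5 * h + (t ^ 2 + t ^ 3) * u ^ 4 * h2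
      + (t + t ^ 2 - t ^ 4 - t ^ 5 - t ^ 6) * u ^ 3 * h3 + (-t ^ 6 - t ^ 7 - t ^ 8) * u ^ 2 * h4
      + (-t ^ 2 - 2 * t ^ 3 - t ^ 4 + t ^ 5 + 2 * t ^ 6 + 2 * t ^ 7 + t ^ 8 - t ^ 9 - 2 * t ^ 10
        - t ^ 11) * u * h5
      + (t ^ 3 + t ^ 4 - t ^ 6 - t ^ 7 - t ^ 8 + t ^ 10 + t ^ 11) * h6
  have key : u ^ 6 * (den t * (1 - u))
      = u ^ 6 * (numPos t u * ((1 - v * t) * (1 - v ^ 2 * t) * (1 - v ^ 3 * t))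
        + numNeg t v * ((1 - u * t) * (1 - u ^ 2 * t) * (1 - u ^ 3 * t))) := by
    rw [mul_add, mul_left_comm (u ^ 6) (numPos t u), e1, ← mul_assoc (u ^ 6) (numNeg t v), e2]
    unfold den numPos
    ring
  have := congrArg (fun z => v ^ 6 * z) key
  simp only [← mul_assoc, mul_comm (v ^ 6) (u ^ 6), h6, one_mul] at this
  simpa only [← mul_assoc] using this

/-- The generating function of the monomials in `a_0, …, a_6` by degree and weight. -/
def monomialSeries : PowerSeries ℤ[T;T⁻¹] := ∏ i : Fin 7, geom (T ((i : ℤ) - 3))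

lemma constTerm_monomialSeries :
    (den PowerSeries.X * (1 - PowerSeries.X)) *
        constTerm ((1 - PowerSeries.C (T 1)) * monomialSeries)
      = 1 + PowerSeries.X - PowerSeries.X ^ 3 - PowerSeries.X ^ 4 - PowerSeries.X ^ 5
        + PowerSeries.X ^ 7 + PowerSeries.X ^ 8 := by
  set t : PowerSeries ℤ[T;T⁻¹] := PowerSeries.X
  set u : PowerSeries ℤ[T;T⁻¹] := PowerSeries.C (T 1)
  set v : PowerSeries ℤ[T;T⁻¹] := PowerSeries.C (T (-1))
  have huv : u * v = 1 := by
    show PowerSeries.C (T 1 : ℤ[T;T⁻¹]) * PowerSeries.C (T (-1)) = 1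
    rw [← map_mul, ← T_add]
    simp
  have hu (n : ℕ) : u ^ n = PowerSeries.C (T n) := by
    show PowerSeries.C (T 1 : ℤ[T;T⁻¹]) ^ n = _
    rw [← map_pow, T_pow, mul_one]
  have hv (n : ℕ) : v ^ n = PowerSeries.C (T (-n)) := by
    show PowerSeries.C (T (-1) : ℤ[T;T⁻¹]) ^ n = _
    rw [← map_pow, T_pow, mul_neg, mul_one]
  have gp1 : geom (T 1 : ℤ[T;T⁻¹]) * (1 - u * t) = 1 := geom_mul _
  have gp2 : geom (T 2 : ℤ[T;T⁻¹]) * (1 - u ^ 2 * t) = 1 := by rw [hu]; exact geom_mul _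
  have gp3 : geom (T 3 : ℤ[T;T⁻¹]) * (1 - u ^ 3 * t) = 1 := by rw [hu]; exact geom_mul _
  have gn1 : geom (T (-1) : ℤ[T;T⁻¹]) * (1 - v * t) = 1 := geom_mul _
  have gn2 : geom (T (-2) : ℤ[T;T⁻¹]) * (1 - v ^ 2 * t) = 1 := by rw [hv]; exact geom_mul _
  have gn3 : geom (T (-3) : ℤ[T;T⁻¹]) * (1 - v ^ 3 * t) = 1 := by rw [hv]; exact geom_mul _
  have g0 : geom (T 0 : ℤ[T;T⁻¹]) * (1 - t) = 1 := by
    have := geom_mul (T 0 : ℤ[T;T⁻¹])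
    simpa using this
  have hprod : monomialSeries = geom (T (-3)) * geom (T (-2)) * geom (T (-1)) * geom (T 0)
      * geom (T 1) * geom (T 2) * geom (T 3) := by
    simp [monomialSeries, Fin.prod_univ_succ]
    ring
  have split : (den t * (1 - t)) * ((1 - u) * monomialSeries)
      = numPos t u * (geom (T 1) * geom (T 2) * geom (T 3))
        + numNeg t v * (geom (T (-1)) * geom (T (-2)) * geom (T (-3))) := by
    have pf := partial_fractions t u v huv
    have gp : geom (T 1 : ℤ[T;T⁻¹]) * geom (T 2) * geom (T 3)
        * ((1 - u * t) * (1 - u ^ 2 * t) * (1 - u ^ 3 * t)) = 1 := by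
      calc _ = (geom (T 1 : ℤ[T;T⁻¹]) * (1 - u * t)) * (geom (T 2 : ℤ[T;T⁻¹]) * (1 - u ^ 2 * t))
            * (geom (T 3 : ℤ[T;T⁻¹]) * (1 - u ^ 3 * t)) := by ring
        _ = 1 := by rw [gp1, gp2, gp3]; ring
    have gn : geom (T (-1) : ℤ[T;T⁻¹]) * geom (T (-2)) * geom (T (-3))
        * ((1 - v * t) * (1 - v ^ 2 * t) * (1 - v ^ 3 * t)) = 1 := by
      calc _ = (geom (T (-1) : ℤ[T;T⁻¹]) * (1 - v * t)) * (geom (T (-2) : ℤ[T;T⁻¹]) * (1 - v ^ 2 * t))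
            * (geom (T (-3) : ℤ[T;T⁻¹]) * (1 - v ^ 3 * t)) := by ring
        _ = 1 := by rw [gn1, gn2, gn3]; ring
    generalize geom (T 0 : ℤ[T;T⁻¹]) = z0 at *
    rw [hprod]
    set Gp := geom (T 1 : ℤ[T;T⁻¹]) * geom (T 2) * geom (T 3) with hGp
    set Gn := geom (T (-1) : ℤ[T;T⁻¹]) * geom (T (-2)) * geom (T (-3)) with hGn
    calc _ = (z0 * (1 - t)) * (den t * (1 - u)) * (Gn * Gp) := by rw [hGp, hGn]; ring
      _ = numPos t u * Gp * (Gn * ((1 - v * t) * (1 - v ^ 2 * t) * (1 - v ^ 3 * t)))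
          + numNeg t v * Gn * (Gp * ((1 - u * t) * (1 - u ^ 2 * t) * (1 - u ^ 3 * t))) := by
        rw [g0, pf]; ring
      _ = _ := by rw [gp, gn, mul_one, mul_one]
  have m2 := map_ofNat (PowerSeries.map (LaurentPolynomial.C : ℤ →+* ℤ[T;T⁻¹])) 2
  have m3 := map_ofNat (PowerSeries.map (LaurentPolynomial.C : ℤ →+* ℤ[T;T⁻¹])) 3
  have m4 := map_ofNat (PowerSeries.map (LaurentPolynomial.C : ℤ →+* ℤ[T;T⁻¹])) 4
  have hden : den t * (1 - t) = PowerSeries.map (LaurentPolynomial.C : ℤ →+* ℤ[T;T⁻¹])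
      (den PowerSeries.X * (1 - PowerSeries.X)) := by
    simp only [den, t, map_mul, map_add, map_sub, map_pow, PowerSeries.map_X, map_one, m2, m3, m4]
  let pp : PowerSeries (Polynomial ℤ) :=
    numPos PowerSeries.X (PowerSeries.C Polynomial.X) *
      (geom Polynomial.X * geom (Polynomial.X ^ 2) * geom (Polynomial.X ^ 3))
  let pn : PowerSeries (Polynomial ℤ) :=
    numNeg PowerSeries.X (PowerSeries.C Polynomial.X) *
      (geom Polynomial.X * geom (Polynomial.X ^ 2) * geom (Polynomial.X ^ 3))
  have hpos : numPos t u * (geom (T 1) * geom (T 2) * geom (T 3))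
      = PowerSeries.map Polynomial.toLaurent pp := by
    simp only [pp, numPos, map_geom, t, u, map_mul, map_add, map_sub, map_neg, map_pow,
      PowerSeries.map_X, PowerSeries.map_C, map_one, map_ofNat, Polynomial.toLaurent_X, T_pow]
    norm_num
  have hneg : numNeg t v * (geom (T (-1)) * geom (T (-2)) * geom (T (-3)))
      = PowerSeries.map (((LaurentPolynomial.invert : ℤ[T;T⁻¹] ≃ₐ[ℤ] ℤ[T;T⁻¹]) : ℤ[T;T⁻¹] →+* ℤ[T;T⁻¹]).comp
          Polynomial.toLaurent) pn := by
    have hX : (((LaurentPolynomial.invert : ℤ[T;T⁻¹] ≃ₐ[ℤ] ℤ[T;T⁻¹]) : ℤ[T;T⁻¹] →+* ℤ[T;T⁻¹]).comp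
          Polynomial.toLaurent) Polynomial.X = T (-1) := by
      simp [Polynomial.toLaurent_X]
    simp only [pn, numNeg, map_geom, t, v, map_mul, map_add, map_sub, map_neg, map_pow,
      PowerSeries.map_X, PowerSeries.map_C, map_ofNat, hX, T_pow]
    norm_num
  rw [hpos, hneg, hden] at split
  have := congrArg constTerm split
  rw [constTerm_map_C_mul, constTerm_add, constTerm_map_toLaurent,
    constTerm_map_invert_toLaurent] at this
  rw [this]
  simp only [pp, pn, map_mul, map_geom, numPos, numNeg, map_add, map_sub, map_pow,
    PowerSeries.map_X, PowerSeries.map_C, map_one, map_neg, map_ofNat]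
  have g1 : geom (0 : ℤ) = 1 := by
    have := geom_mul (0 : ℤ)
    simpa using this
  simp [g1]

end GeneratingFunction

section Counting

open PowerSeries LaurentPolynomial

/-- The weight `∑ lᵢ (i - 3)` of the monomial with exponents `l`. -/
def expWeight (l : Fin 7 →₀ ℕ) : ℤ := ∑ i : Fin 7, (l i : ℤ) * ((i : ℤ) - 3)

/-- The exponents of the monomials of degree `d` and weight `w`. -/
def weightExps (d : ℕ) (w : ℤ) : Finset (Fin 7 →₀ ℕ) :=
  ((Finset.univ : Finset (Fin 7)).finsuppAntidiag d).filter fun l => expWeight l = w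

/-- The degrees of the basic invariants of even degree. -/
def basicDeg : Fin 4 → ℕ := ![2, 4, 6, 10]

/-- The exponents `l` of total degree `d` with each `lᵢ` a multiple of the `i`-th basic degree. -/
def basicExps (d : ℕ) : Finset (Fin 4 →₀ ℕ) :=
  ((Finset.univ : Finset (Fin 4)).finsuppAntidiag d).filter fun l => ∀ i, basicDeg i ∣ l i

lemma T_finset_sum {ι : Type*} (s : Finset ι) (f : ι → ℤ) :
    (T (∑ i ∈ s, f i) : ℤ[T;T⁻¹]) = ∏ i ∈ s, T (f i) := by
  classical
  induction s using Finset.induction_on with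
  | empty => simp
  | insert a s ha ih => rw [Finset.sum_insert ha, Finset.prod_insert ha, T_add, ih]

lemma coeff_monomialSeries (d : ℕ) :
    PowerSeries.coeff d monomialSeries
      = ∑ l ∈ (Finset.univ : Finset (Fin 7)).finsuppAntidiag d, (T (expWeight l) : ℤ[T;T⁻¹]) := by
  rw [monomialSeries, PowerSeries.coeff_prod]
  refine Finset.sum_congr rfl fun l _ => ?_
  rw [expWeight, T_finset_sum]
  refine Finset.prod_congr rfl fun i _ => ?_
  rw [geom, PowerSeries.coeff_mk, T_pow]

lemma coeff_constTerm (k : ℤ) (d : ℕ) :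
    PowerSeries.coeff d (constTerm (PowerSeries.C (T k) * monomialSeries))
      = ((weightExps d (-k)).card : ℤ) := by
  rw [constTerm, PowerSeries.coeff_mk, PowerSeries.coeff_C_mul, coeff_monomialSeries,
    Finset.mul_sum, AddMonoidAlgebra.coeff_sum, Finsupp.coe_finsetSum, Finset.sum_apply,
    weightExps, Finset.card_filter, Nat.cast_sum]
  refine Finset.sum_congr rfl fun l _ => ?_
  rw [← T_add, LaurentPolynomial.T_apply]
  have : k + expWeight l = 0 ↔ expWeight l = -k := by omega
  simp [this]

/-- The series `1 / (1 - t ^ k)`. -/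
def stepSeries (k : ℕ) : PowerSeries ℤ := PowerSeries.mk fun n => if k ∣ n then 1 else 0

lemma stepSeries_mul {k : ℕ} (hk : 0 < k) : stepSeries k * (1 - PowerSeries.X ^ k) = 1 := by
  ext n
  rw [mul_sub, mul_one, map_sub, PowerSeries.coeff_mul_X_pow', PowerSeries.coeff_one]
  simp only [stepSeries, PowerSeries.coeff_mk]
  rcases Nat.lt_or_ge n k with h | h
  · rcases Nat.eq_zero_or_pos n with rfl | hn
    · simp [hk.ne']
    · have : ¬ k ∣ n := fun h' => by have := Nat.le_of_dvd hn h'; omega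
      simp [this, hn.ne', h]
  · have h1 : k ∣ n - k ↔ k ∣ n := by
      rw [Nat.dvd_sub_iff_left h (dvd_refl k)]
    have : n ≠ 0 := by omega
    simp [h, h1, this]

lemma coeff_prod_stepSeries (d : ℕ) :
    PowerSeries.coeff d (∏ i, stepSeries (basicDeg i)) = ((basicExps d).card : ℤ) := by
  rw [PowerSeries.coeff_prod, basicExps, Finset.card_filter, Nat.cast_sum]
  refine Finset.sum_congr rfl fun l _ => ?_
  simp only [stepSeries, PowerSeries.coeff_mk]
  rw [Finset.prod_ite_zero]
  simp

lemma constTerm_eq :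
    constTerm ((1 - PowerSeries.C (T 1)) * monomialSeries)
      = (∏ i, stepSeries (basicDeg i)) * (1 + PowerSeries.X ^ 15) := by
  have h0 : (den PowerSeries.X * (1 - PowerSeries.X) : PowerSeries ℤ) ≠ 0 := by
    intro h
    have := congrArg PowerSeries.constantCoeff h
    simp [den] at this
  have hD : (∏ i, stepSeries (basicDeg i)) * ((1 - PowerSeries.X ^ 2) * (1 - PowerSeries.X ^ 4)
      * (1 - PowerSeries.X ^ 6) * (1 - PowerSeries.X ^ 10)) = (1 : PowerSeries ℤ) := by
    have h2 := stepSeries_mul (k := 2) (by norm_num)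
    have h4 := stepSeries_mul (k := 4) (by norm_num)
    have h6 := stepSeries_mul (k := 6) (by norm_num)
    have h10 := stepSeries_mul (k := 10) (by norm_num)
    have : (∏ i, stepSeries (basicDeg i))
        = stepSeries 2 * stepSeries 4 * stepSeries 6 * stepSeries 10 := by
      simp [Fin.prod_univ_four, basicDeg]
    rw [this]
    calc _ = (stepSeries 2 * (1 - PowerSeries.X ^ 2)) * (stepSeries 4 * (1 - PowerSeries.X ^ 4))
          * (stepSeries 6 * (1 - PowerSeries.X ^ 6))
          * (stepSeries 10 * (1 - PowerSeries.X ^ 10)) := by ring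
      _ = 1 := by rw [h2, h4, h6, h10]; ring
  apply mul_left_cancel₀ h0
  rw [constTerm_monomialSeries]
  have e : (den PowerSeries.X * (1 - PowerSeries.X)) * (1 + PowerSeries.X ^ 15)
      = ((1 + PowerSeries.X - PowerSeries.X ^ 3 - PowerSeries.X ^ 4 - PowerSeries.X ^ 5
        + PowerSeries.X ^ 7 + PowerSeries.X ^ 8) : PowerSeries ℤ)
        * ((1 - PowerSeries.X ^ 2) * (1 - PowerSeries.X ^ 4)
      * (1 - PowerSeries.X ^ 6) * (1 - PowerSeries.X ^ 10)) := by
    unfold den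
    ring
  rw [mul_comm (∏ i, stepSeries (basicDeg i)), ← mul_assoc, e, mul_assoc _ _ (∏ i, _),
    mul_comm _ (∏ i, _), hD, mul_one]

lemma even_of_mem_basicExps {d : ℕ} {l : Fin 4 →₀ ℕ} (h : l ∈ basicExps d) : Even d := by
  rw [basicExps, Finset.mem_filter, Finset.mem_finsuppAntidiag] at h
  rw [← h.1.1, even_iff_two_dvd]
  refine Finset.dvd_sum fun i _ => dvd_trans ?_ (h.2 i)
  fin_cases i <;> simp [basicDeg]

lemma card_weightExps_sub (d : ℕ) :
    ((weightExps d 0).card : ℤ) - (weightExps d (-1)).card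
      = (basicExps d).card + if 15 ≤ d then ((basicExps (d - 15)).card : ℤ) else 0 := by
  have := congrArg (PowerSeries.coeff d) constTerm_eq
  have hs : constTerm ((1 - PowerSeries.C (T 1)) * monomialSeries)
      + constTerm (PowerSeries.C (T 1) * monomialSeries)
        = constTerm (PowerSeries.C (T 0) * monomialSeries) := by
    rw [← constTerm_add, ← add_mul, T_zero, map_one]
    ring_nf
  rw [mul_add, mul_one, map_add, coeff_prod_stepSeries, PowerSeries.coeff_mul_X_pow',
    coeff_prod_stepSeries] at this
  rw [← this]
  have hs' := congrArg (PowerSeries.coeff d) hs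
  rw [map_add, coeff_constTerm, coeff_constTerm] at hs'
  simp only [neg_zero] at hs'
  linarith

lemma basicExps_eq_empty {d : ℕ} (h : ¬ Even d) : basicExps d = ∅ :=
  Finset.eq_empty_of_forall_notMem fun _ hl => h (even_of_mem_basicExps hl)

lemma card_weightExps_sub_of_even {d : ℕ} (hd : Even d) :
    (weightExps d 0).card = (weightExps d (-1)).card + (basicExps d).card := by
  have := card_weightExps_sub d
  split_ifs at this with h
  · rw [basicExps_eq_empty (d := d - 15) (by rw [Nat.even_sub h]; simp [hd]; decide),
      Finset.card_empty] at this
    push_cast at this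
    omega
  · omega

lemma card_weightExps_sub_of_odd {d : ℕ} (hd : Odd d) (h : 15 ≤ d) :
    (weightExps d 0).card = (weightExps d (-1)).card + (basicExps (d - 15)).card := by
  have := card_weightExps_sub d
  rw [if_pos h, basicExps_eq_empty (Nat.not_even_iff_odd.2 hd), Finset.card_empty] at this
  push_cast at this
  omega

lemma card_weightExps_sub_of_odd_of_lt {d : ℕ} (hd : Odd d) (h : d < 15) :
    (weightExps d 0).card = (weightExps d (-1)).card := by
  have := card_weightExps_sub d
  rw [if_neg (by omega), basicExps_eq_empty (Nat.not_even_iff_odd.2 hd), Finset.card_empty] at this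
  push_cast at this
  omega

end Counting

section Derivations

/-- The raising operator of `sl₂`, acting on polynomials in the coefficients of a sextic. -/
def raise : Derivation ℂ (MvPolynomial (Fin 7) ℂ) (MvPolynomial (Fin 7) ℂ) :=
  ∑ i : Fin 6, (C (6 - (i : ℂ)) * X i.castSucc : MvPolynomial (Fin 7) ℂ) • pderiv i.succ

/-- The lowering operator of `sl₂`, acting on polynomials in the coefficients of a sextic. -/
def lower : Derivation ℂ (MvPolynomial (Fin 7) ℂ) (MvPolynomial (Fin 7) ℂ) :=
  ∑ i : Fin 6, (C ((i : ℂ) + 1) * X i.succ : MvPolynomial (Fin 7) ℂ) • pderiv i.castSucc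

/-- The bidegree `(1, i - 3)` of the variable `a_i`. -/
def bidegree (i : Fin 7) : ℤ × ℤ := (1, (i : ℤ) - 3)

/-- The polynomials of degree `d` and weight `w`. -/
abbrev weightSpace (d w : ℤ) : Submodule ℂ (MvPolynomial (Fin 7) ℂ) :=
  weightedHomogeneousSubmodule ℂ bidegree (d, w)

lemma weight_bidegree (m : Fin 7 →₀ ℕ) :
    Finsupp.weight bidegree m = ((m.degree : ℤ), expWeight m) := by
  rw [Finsupp.weight_apply, Finsupp.sum_fintype _ _ (by simp), Finsupp.degree_eq_sum]
  ext
  · simp [bidegree, Prod.fst_sum]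
  · simp [bidegree, Prod.snd_sum, expWeight]

lemma mem_weightSpace {d w : ℤ} {p : MvPolynomial (Fin 7) ℂ} :
    p ∈ weightSpace d w ↔ ∀ m, coeff m p ≠ 0 → (m.degree : ℤ) = d ∧ expWeight m = w := by
  rw [weightSpace, mem_weightedHomogeneousSubmodule, IsWeightedHomogeneous]
  simp only [weight_bidegree, Prod.mk.injEq]

lemma derivation_sum_apply {ι : Type*} (s : Finset ι)
    (D : ι → Derivation ℂ (MvPolynomial (Fin 7) ℂ) (MvPolynomial (Fin 7) ℂ))
    (p : MvPolynomial (Fin 7) ℂ) : (∑ i ∈ s, D i) p = ∑ i ∈ s, D i p := by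
  classical
  induction s using Finset.induction_on with
  | empty => simp
  | insert a s ha ih => rw [Finset.sum_insert ha, Finset.sum_insert ha, Derivation.add_apply, ih]

lemma raise_apply (p : MvPolynomial (Fin 7) ℂ) :
    raise p = ∑ i : Fin 6, C (6 - (i : ℂ)) * X i.castSucc * pderiv i.succ p := by
  simp [raise, derivation_sum_apply]

lemma lower_apply (p : MvPolynomial (Fin 7) ℂ) :
    lower p = ∑ i : Fin 6, C ((i : ℂ) + 1) * X i.succ * pderiv i.castSucc p := by
  simp [lower, derivation_sum_apply]

lemma raise_mem {d w : ℤ} {p : MvPolynomial (Fin 7) ℂ} (hp : p ∈ weightSpace d w) :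
    raise p ∈ weightSpace d (w - 1) := by
  rw [raise_apply]
  refine Submodule.sum_mem _ fun i _ => ?_
  rw [mem_weightedHomogeneousSubmodule] at hp ⊢
  have h1 : (pderiv i.succ p).IsWeightedHomogeneous bidegree ((d, w) - bidegree i.succ) :=
    IsWeightedHomogeneous.pderiv hp (by simp)
  have h2 := ((isWeightedHomogeneous_X ℂ bidegree i.castSucc).C_mul (6 - (i : ℂ))).mul h1
  convert h2 using 1
  simp [bidegree]
  ring

lemma lower_mem {d w : ℤ} {p : MvPolynomial (Fin 7) ℂ} (hp : p ∈ weightSpace d w) :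
    lower p ∈ weightSpace d (w + 1) := by
  rw [lower_apply]
  refine Submodule.sum_mem _ fun i _ => ?_
  rw [mem_weightedHomogeneousSubmodule] at hp ⊢
  have h1 : (pderiv i.castSucc p).IsWeightedHomogeneous bidegree ((d, w) - bidegree i.castSucc) :=
    IsWeightedHomogeneous.pderiv hp (by simp)
  have h2 := ((isWeightedHomogeneous_X ℂ bidegree i.succ).C_mul ((i : ℂ) + 1)).mul h1
  convert h2 using 1
  simp [bidegree]
  ring

lemma raise_X (i : Fin 7) :
    raise (X i) = ![0, (6 : ℂ) • X 0, (5 : ℂ) • X 1, (4 : ℂ) • X 2, (3 : ℂ) • X 3,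
      (2 : ℂ) • X 4, X 5] i := by
  rw [raise_apply]
  simp_rw [← smul_eq_C_mul, smul_mul_assoc]
  fin_cases i <;> simp [Fin.sum_univ_succ, pderiv_X, Pi.single_apply, -map_sub] <;>
    norm_num [Fin.ext_iff]

lemma lower_X (i : Fin 7) :
    lower (X i) = ![X 1, (2 : ℂ) • X 2, (3 : ℂ) • X 3, (4 : ℂ) • X 4, (5 : ℂ) • X 5,
      (6 : ℂ) • X 6, 0] i := by
  rw [lower_apply]
  simp_rw [← smul_eq_C_mul, smul_mul_assoc]
  fin_cases i <;> simp [Fin.sum_univ_succ, pderiv_X, Pi.single_apply, -map_sub] <;>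
    norm_num [Fin.ext_iff]

/-- The Cartan element of `sl₂`, as the commutator of the raising and lowering operators. -/
lemma raise_lower_sub (p : MvPolynomial (Fin 7) ℂ) :
    raise (lower p) - lower (raise p)
      = ∑ i : Fin 7, C (6 - 2 * (i : ℂ)) * (X i * pderiv i p) := by
  have h : ⁅raise, lower⁆
      = ∑ i : Fin 7, (C (6 - 2 * (i : ℂ)) * X i : MvPolynomial (Fin 7) ℂ) • pderiv i := by
    refine derivation_ext fun i => ?_
    rw [Derivation.commutator_apply, raise_X, lower_X, derivation_sum_apply]
    simp_rw [← smul_eq_C_mul, Derivation.smul_apply, smul_assoc]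
    fin_cases i <;>
      simp [pderiv_X, Pi.single_apply, raise_X, lower_X, smul_smul, -map_sub] <;> module
  rw [← Derivation.commutator_apply, h, derivation_sum_apply]
  simp [mul_assoc]

lemma coeff_X_mul_pderiv (i : Fin 7) (m : Fin 7 →₀ ℕ) (p : MvPolynomial (Fin 7) ℂ) :
    coeff m (X i * pderiv i p) = m i * coeff m p := by
  induction p using MvPolynomial.induction_on' with
  | monomial n c =>
    rw [X_mul_pderiv_monomial, coeff_smul, coeff_monomial]
    split_ifs with h
    · rw [h, nsmul_eq_mul]
    · simp
  | add p q hp hq => rw [map_add, mul_add, coeff_add, hp, hq, coeff_add, mul_add]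

lemma coeff_raise_lower_sub (m : Fin 7 →₀ ℕ) (p : MvPolynomial (Fin 7) ℂ) :
    coeff m (raise (lower p) - lower (raise p)) = -2 * expWeight m * coeff m p := by
  rw [raise_lower_sub, coeff_sum]
  simp_rw [coeff_C_mul, coeff_X_mul_pderiv, expWeight]
  push_cast
  rw [Finset.mul_sum, Finset.sum_mul]
  refine Finset.sum_congr rfl fun i _ => ?_
  ring

lemma raise_lower_eq {d w : ℤ} {p : MvPolynomial (Fin 7) ℂ} (hp : p ∈ weightSpace d w) :
    raise (lower p) = lower (raise p) - (2 * w : ℂ) • p := by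
  have h : raise (lower p) - lower (raise p) = -((2 * w : ℂ) • p) := by
    ext m
    rw [coeff_raise_lower_sub, coeff_neg, coeff_smul, smul_eq_mul]
    by_cases hm : coeff m p = 0
    · simp [hm]
    · rw [(mem_weightSpace.1 hp m hm).2]
      ring
  rw [sub_eq_iff_eq_add'.1 h, sub_eq_add_neg]

lemma raise_iterate_mem {d w : ℤ} {p : MvPolynomial (Fin 7) ℂ} (hp : p ∈ weightSpace d w)
    (n : ℕ) : raise^[n] p ∈ weightSpace d (w - n) := by
  induction n with
  | zero => simpa using hp
  | succ n ih =>
    rw [Function.iterate_succ_apply']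
    convert raise_mem ih using 2
    push_cast
    ring

lemma raise_iterate_succ_lower {d w : ℤ} {p : MvPolynomial (Fin 7) ℂ} (hp : p ∈ weightSpace d w)
    (n : ℕ) : raise^[n + 1] (lower p)
      = lower (raise^[n + 1] p) + ((n + 1) * (n - 2 * w) : ℂ) • raise^[n] p := by
  induction n with
  | zero =>
    simp only [zero_add, Function.iterate_one, Function.iterate_zero, id, raise_lower_eq hp]
    push_cast
    module
  | succ n ih =>
    rw [Function.iterate_succ_apply', ih, map_add, Derivation.map_smul,
      raise_lower_eq (raise_iterate_mem hp (n + 1)), ← Function.iterate_succ_apply' raise,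
      ← Function.iterate_succ_apply' raise]
    push_cast
    module

lemma exists_raise_eq_of_iterate_eq_zero {d w : ℤ} (hw : w < 0) (n : ℕ) :
    ∀ p ∈ weightSpace d w, raise^[n] p = 0 → ∃ q ∈ weightSpace d (w + 1), raise q = p := by
  induction n with
  | zero =>
    intro p _ h
    exact ⟨0, Submodule.zero_mem _, by simpa using h.symm⟩
  | succ n ih =>
    intro p hp h
    set c : ℂ := (n + 1) * (n - 2 * w) with hc
    have hc0 : c ≠ 0 := by
      have h1 : ((n : ℤ) + 1) * (n - 2 * w) ≠ 0 := by
        apply mul_ne_zero <;> omega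
      rw [hc]
      exact_mod_cast h1
    have hmem : raise (lower p) - c • p ∈ weightSpace d w := by
      refine Submodule.sub_mem _ ?_ (Submodule.smul_mem _ _ hp)
      simpa using raise_mem (lower_mem hp)
    have hit : raise^[n] (raise (lower p) - c • p) = 0 := by
      have hlin (q r : MvPolynomial (Fin 7) ℂ) :
          raise^[n] (q - c • r) = raise^[n] q - c • raise^[n] r := by
        have : ∀ k (q : MvPolynomial (Fin 7) ℂ),
            raise^[k] q = ((raise : MvPolynomial (Fin 7) ℂ →ₗ[ℂ] _) ^ k) q := by
          intro k q
          rw [Module.End.pow_apply]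
          rfl
        rw [this, this, this, map_sub, map_smul]
      rw [hlin, ← Function.iterate_succ_apply, raise_iterate_succ_lower hp, h, map_zero]
      simp [hc]
    obtain ⟨q, hq, hqe⟩ := ih _ hmem hit
    refine ⟨c⁻¹ • (lower p - q), Submodule.smul_mem _ _
      (Submodule.sub_mem _ (lower_mem hp) hq), ?_⟩
    rw [Derivation.map_smul, map_sub, hqe, sub_sub_cancel, smul_smul, inv_mul_cancel₀ hc0, one_smul]

lemma neg_le_expWeight (m : Fin 7 →₀ ℕ) : -(3 * (m.degree : ℤ)) ≤ expWeight m := by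
  rw [Finsupp.degree_eq_sum, expWeight]
  push_cast
  rw [Finset.mul_sum, ← Finset.sum_neg_distrib]
  refine Finset.sum_le_sum fun i _ => ?_
  nlinarith [Int.natCast_nonneg (m i), Int.natCast_nonneg (i : ℕ)]

lemma eq_zero_of_mem_weightSpace {d w : ℤ} (h : w < -(3 * d)) {p : MvPolynomial (Fin 7) ℂ}
    (hp : p ∈ weightSpace d w) : p = 0 := by
  ext m
  by_contra hm
  rw [coeff_zero] at hm
  obtain ⟨h1, h2⟩ := mem_weightSpace.1 hp m hm
  have := neg_le_expWeight m
  rw [h1, h2] at this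
  omega

lemma exists_raise_eq {d w : ℤ} (hw : w < 0) {p : MvPolynomial (Fin 7) ℂ}
    (hp : p ∈ weightSpace d w) : ∃ q ∈ weightSpace d (w + 1), raise q = p := by
  refine exists_raise_eq_of_iterate_eq_zero hw (w + 3 * d + 1).toNat p hp
    (eq_zero_of_mem_weightSpace ?_ (raise_iterate_mem hp _))
  omega

lemma coe_weightExps (d : ℕ) (w : ℤ) :
    {m : Fin 7 →₀ ℕ | Finsupp.weight bidegree m = ((d : ℤ), w)} = weightExps d w := by
  ext m
  simp [weightExps, weight_bidegree, Finsupp.degree_eq_sum, Finset.mem_finsuppAntidiag]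
  norm_cast
  exact fun _ => Iff.rfl

lemma finrank_weightSpace (d : ℕ) (w : ℤ) :
    Module.finrank ℂ (weightSpace d w) = (weightExps d w).card := by
  have h : weightSpace d w = restrictSupport ℂ (weightExps d w : Set (Fin 7 →₀ ℕ)) := by
    rw [← coe_weightExps]
    exact weightedHomogeneousSubmodule_eq_finsupp_supported _ _ _
  rw [h, Module.finrank_eq_card_basis (basisRestrictSupport ℂ _)]
  simp

instance (d : ℕ) (w : ℤ) : FiniteDimensional ℂ (weightSpace d w) := by
  have h : weightSpace d w = restrictSupport ℂ (weightExps d w : Set (Fin 7 →₀ ℕ)) := by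
    rw [← coe_weightExps]
    exact weightedHomogeneousSubmodule_eq_finsupp_supported _ _ _
  rw [h]
  exact Module.Finite.of_basis (basisRestrictSupport ℂ _)

lemma mem_span_of_mem_ker {V W ι : Type*} [AddCommGroup V] [Module ℂ V] [AddCommGroup W]
    [Module ℂ W] [FiniteDimensional ℂ V] [Fintype ι] (e : V →ₗ[ℂ] W)
    (he : Function.Surjective e)
    (hcard : Module.finrank ℂ V = Module.finrank ℂ W + Fintype.card ι)
    (v : ι → V) (hv : LinearIndependent ℂ v) (hr : ∀ i, e (v i) = 0) {p : V} (hp : e p = 0) :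
    p ∈ Submodule.span ℂ (Set.range v) := by
  have hk := e.finrank_range_add_finrank_ker
  rw [LinearMap.range_eq_top.2 he, finrank_top] at hk
  let v' : ι → LinearMap.ker e := fun i => ⟨v i, hr i⟩
  have hv' : LinearIndependent ℂ v' := LinearIndependent.of_comp (LinearMap.ker e).subtype hv
  have hspan := hv'.span_eq_top_of_card_eq_finrank' (by omega)
  have hp' : (⟨p, hp⟩ : LinearMap.ker e) ∈ Submodule.span ℂ (Set.range v') := by
    rw [hspan]; trivial
  have := Submodule.mem_map_of_mem (f := (LinearMap.ker e).subtype) hp'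
  rw [Submodule.map_span, ← Set.range_comp] at this
  exact this

/-- The raising operator from weight zero to weight minus one. -/
def raiseZero (d : ℕ) : weightSpace d 0 →ₗ[ℂ] weightSpace d (-1) where
  toFun q := ⟨raise q, by simpa using raise_mem q.2⟩
  map_add' q r := Subtype.ext (by simp)
  map_smul' c q := Subtype.ext (by simp)

lemma raiseZero_surjective (d : ℕ) : Function.Surjective (raiseZero d) := by
  rintro ⟨q, hq⟩
  obtain ⟨r, hr, hrq⟩ := exists_raise_eq (by norm_num) hq
  exact ⟨⟨r, by simpa using hr⟩, Subtype.ext hrq⟩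

/-- A linearly independent family of highest weight vectors of weight zero and of the right size
spans all of them. -/
lemma mem_span_of_raise_eq_zero {d : ℕ} {ι : Type*} [Fintype ι]
    (hcard : (weightExps d 0).card = (weightExps d (-1)).card + Fintype.card ι)
    (v : ι → MvPolynomial (Fin 7) ℂ) (hv : LinearIndependent ℂ v)
    (hw : ∀ i, v i ∈ weightSpace d 0) (hr : ∀ i, raise (v i) = 0)
    {p : MvPolynomial (Fin 7) ℂ} (hp : p ∈ weightSpace d 0) (hpr : raise p = 0) :
    p ∈ Submodule.span ℂ (Set.range v) := by
  have hv' : LinearIndependent ℂ fun i => (⟨v i, hw i⟩ : weightSpace d 0) :=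
    LinearIndependent.of_comp (weightSpace d 0).subtype hv
  have key := mem_span_of_mem_ker (raiseZero d) (raiseZero_surjective d)
    (by rw [finrank_weightSpace, finrank_weightSpace, hcard]) _ hv'
    (fun i => Subtype.ext (hr i)) (p := ⟨p, hp⟩) (Subtype.ext hpr)
  have := Submodule.mem_map_of_mem (f := (weightSpace d 0).subtype) key
  rw [Submodule.map_span, ← Set.range_comp] at this
  exact this

end Derivations

section Action

/-- The linear substitution of variables given by a `2 × 2` matrix. -/
def subst (g : Matrix.SpecialLinearGroup (Fin 2) ℂ) (j : Fin 2) : MvPolynomial (Fin 2) ℂ :=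
  C (g.1 j 0) * X 0 + C (g.1 j 1) * X 1

lemma coeff_formPoly (n : ℕ) (a : Fin (n + 1) → ℂ) (i : Fin (n + 1)) :
    coeff (Finsupp.single 0 (n - (i : ℕ)) + Finsupp.single 1 (i : ℕ)) (formPoly n a) = a i := by
  have h (k : Fin (n + 1)) : (C (a k) * X 0 ^ (n - (k : ℕ)) * X 1 ^ (k : ℕ) :
      MvPolynomial (Fin 2) ℂ)
        = monomial (Finsupp.single 0 (n - (k : ℕ)) + Finsupp.single 1 (k : ℕ)) (a k) := by
    rw [X_pow_eq_monomial, X_pow_eq_monomial, C_mul_monomial, monomial_mul, mul_one, mul_one]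
  simp_rw [formPoly, h, coeff_sum, coeff_monomial]
  rw [Finset.sum_eq_single i]
  · simp
  · intro k _ hk
    rw [if_neg]
    intro h
    have := DFunLike.congr_fun h 1
    simp at this
    exact hk (Fin.ext this)
  · simp

lemma sl2Act_eq {n : ℕ} {g : Matrix.SpecialLinearGroup (Fin 2) ℂ} {a b : Fin (n + 1) → ℂ}
    (h : bind₁ (subst g) (formPoly n a) = formPoly n b) : sl2Act n g a = b := by
  ext i
  have hb : bind₁ (fun j : Fin 2 => (C (g.1 j 0) * X 0 + C (g.1 j 1) * X 1 : MvPolynomial ℕ ℂ))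
      (formPoly n a) = rename Fin.val (formPoly n b) := by
    rw [← h, rename_bind₁]
    congr 2
    ext1 j
    simp [subst]
  have he : (Finsupp.single 0 (n - (i : ℕ)) + Finsupp.single 1 (i : ℕ) : ℕ →₀ ℕ)
      = Finsupp.mapDomain Fin.val
        (Finsupp.single (0 : Fin 2) (n - (i : ℕ)) + Finsupp.single (1 : Fin 2) (i : ℕ)) := by
    simp only [Finsupp.mapDomain_add, Finsupp.mapDomain_single]
    rfl
  rw [sl2Act, hb, he, coeff_rename_mapDomain _ Fin.val_injective, coeff_formPoly]

lemma bind₁_subst_mul (g h : Matrix.SpecialLinearGroup (Fin 2) ℂ) (f : MvPolynomial (Fin 2) ℂ) :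
    bind₁ (subst (g * h)) f = bind₁ (subst h) (bind₁ (subst g) f) := by
  rw [bind₁_bind₁]
  congr 2
  ext1 j
  simp [subst, Matrix.mul_apply, Fin.sum_univ_two]
  ring

/-- The action of `x ↦ x + s y` on the coefficients of a sextic. -/
def actUpper {R : Type*} [CommRing R] (s : R) (a : Fin 7 → R) : Fin 7 → R :=
  ![a 0, a 1 + 6 * s * a 0, a 2 + 5 * s * a 1 + 15 * s ^ 2 * a 0,
    a 3 + 4 * s * a 2 + 10 * s ^ 2 * a 1 + 20 * s ^ 3 * a 0,
    a 4 + 3 * s * a 3 + 6 * s ^ 2 * a 2 + 10 * s ^ 3 * a 1 + 15 * s ^ 4 * a 0,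
    a 5 + 2 * s * a 4 + 3 * s ^ 2 * a 3 + 4 * s ^ 3 * a 2 + 5 * s ^ 4 * a 1 + 6 * s ^ 5 * a 0,
    a 6 + s * a 5 + s ^ 2 * a 4 + s ^ 3 * a 3 + s ^ 4 * a 2 + s ^ 5 * a 1 + s ^ 6 * a 0]

/-- The action of `y ↦ s x + y` on the coefficients of a sextic. -/
def actLower {R : Type*} [CommRing R] (s : R) (a : Fin 7 → R) : Fin 7 → R :=
  ![a 0 + s * a 1 + s ^ 2 * a 2 + s ^ 3 * a 3 + s ^ 4 * a 4 + s ^ 5 * a 5 + s ^ 6 * a 6,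
    a 1 + 2 * s * a 2 + 3 * s ^ 2 * a 3 + 4 * s ^ 3 * a 4 + 5 * s ^ 4 * a 5 + 6 * s ^ 5 * a 6,
    a 2 + 3 * s * a 3 + 6 * s ^ 2 * a 4 + 10 * s ^ 3 * a 5 + 15 * s ^ 4 * a 6,
    a 3 + 4 * s * a 4 + 10 * s ^ 2 * a 5 + 20 * s ^ 3 * a 6,
    a 4 + 5 * s * a 5 + 15 * s ^ 2 * a 6, a 5 + 6 * s * a 6, a 6]

/-- The upper unipotent matrix. -/
def upperMat (s : ℂ) : Matrix.SpecialLinearGroup (Fin 2) ℂ := ⟨!![1, s; 0, 1], by simp⟩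

/-- The lower unipotent matrix. -/
def lowerMat (s : ℂ) : Matrix.SpecialLinearGroup (Fin 2) ℂ := ⟨!![1, 0; s, 1], by simp⟩

lemma bind₁_upperMat (s : ℂ) (a : Fin 7 → ℂ) :
    bind₁ (subst (upperMat s)) (formPoly 6 a) = formPoly 6 (actUpper s a) := by
  simp only [formPoly, Fin.sum_univ_succ, map_add, map_mul, map_pow, bind₁_X_right, bind₁_C_right,
    subst, upperMat]
  simp [actUpper, Fin.succ]
  have h (n : ℕ) [n.AtLeastTwo] : (C (OfNat.ofNat n) : MvPolynomial (Fin 2) ℂ)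
    = OfNat.ofNat n := map_ofNat C n
  rw [h 2, h 3, h 4, h 5, h 6, h 10, h 15, h 20]
  ring

lemma bind₁_lowerMat (s : ℂ) (a : Fin 7 → ℂ) :
    bind₁ (subst (lowerMat s)) (formPoly 6 a) = formPoly 6 (actLower s a) := by
  simp only [formPoly, Fin.sum_univ_succ, map_add, map_mul, map_pow, bind₁_X_right, bind₁_C_right,
    subst, lowerMat]
  simp [actLower, Fin.succ]
  have h (n : ℕ) [n.AtLeastTwo] : (C (OfNat.ofNat n) : MvPolynomial (Fin 2) ℂ)
    = OfNat.ofNat n := map_ofNat C n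
  rw [h 2, h 3, h 4, h 5, h 6, h 10, h 15, h 20]
  ring

lemma coe_upperMat (s : ℂ) : (upperMat s).1 = !![1, s; 0, 1] := rfl

lemma coe_lowerMat (s : ℂ) : (lowerMat s).1 = !![1, 0; s, 1] := rfl

lemma eq_upper_lower_upper (g : Matrix.SpecialLinearGroup (Fin 2) ℂ) (h : g.1 1 0 ≠ 0) :
    g = upperMat ((g.1 0 0 - 1) / g.1 1 0) * lowerMat (g.1 1 0)
      * upperMat ((g.1 1 1 - 1) / g.1 1 0) := by
  have hdet := g.2
  rw [Matrix.det_fin_two] at hdet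
  apply Subtype.ext
  rw [Matrix.SpecialLinearGroup.coe_mul, Matrix.SpecialLinearGroup.coe_mul, coe_upperMat,
    coe_lowerMat, coe_upperMat]
  ext i j
  fin_cases i <;> fin_cases j <;> simp [Matrix.mul_apply, Fin.sum_univ_two] <;> field_simp <;>
    first | linear_combination hdet | linear_combination -hdet | linear_combination 0 * hdet

lemma mem_invariantRing_iff {p : MvPolynomial (Fin 7) ℂ} :
    p ∈ invariantRing 6 ↔ (∀ s a, eval (actUpper s a) p = eval a p) ∧
      ∀ s a, eval (actLower s a) p = eval a p := by
  constructor
  · intro h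
    refine ⟨fun s a => ?_, fun s a => ?_⟩
    · rw [← sl2Act_eq (bind₁_upperMat s a)]
      exact h _ _
    · rw [← sl2Act_eq (bind₁_lowerMat s a)]
      exact h _ _
  · rintro ⟨hu, hl⟩
    let P (g : Matrix.SpecialLinearGroup (Fin 2) ℂ) : Prop :=
      ∀ a, ∃ b, bind₁ (subst g) (formPoly 6 a) = formPoly 6 b ∧ eval b p = eval a p
    have Pm (g h) (hg : P g) (hh : P h) : P (g * h) := fun a => by
      obtain ⟨b, hb, hb'⟩ := hg a
      obtain ⟨c, hc, hc'⟩ := hh b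
      exact ⟨c, by rw [bind₁_subst_mul, hb, hc], hc'.trans hb'⟩
    have Pu (s) : P (upperMat s) := fun a => ⟨_, bind₁_upperMat s a, hu s a⟩
    have Pl (s) : P (lowerMat s) := fun a => ⟨_, bind₁_lowerMat s a, hl s a⟩
    have P1 (g) (hg : g.1 1 0 ≠ 0) : P g := by
      rw [eq_upper_lower_upper g hg]
      exact Pm _ _ (Pm _ _ (Pu _) (Pl _)) (Pu _)
    have Pall (g) : P g := by
      by_cases hg : g.1 1 0 = 0
      · have h1 : g = g * lowerMat 1 * lowerMat (-1) := by
          rw [mul_assoc]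
          have : lowerMat 1 * lowerMat (-1) = 1 := by
            apply Subtype.ext
            rw [Matrix.SpecialLinearGroup.coe_mul, coe_lowerMat, coe_lowerMat]
            ext i j
            fin_cases i <;> fin_cases j <;> simp [Matrix.mul_apply, Fin.sum_univ_two]
          rw [this, mul_one]
        rw [h1]
        refine Pm _ _ (P1 _ ?_) (Pl _)
        have hdet := g.2
        rw [Matrix.det_fin_two, hg, mul_zero, sub_zero] at hdet
        have : g.1 1 1 ≠ 0 := right_ne_zero_of_mul (by rw [hdet]; exact one_ne_zero)
        rw [Matrix.SpecialLinearGroup.coe_mul, coe_lowerMat]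
        simpa [Matrix.mul_apply, Fin.sum_univ_two, hg] using this
      · exact P1 g hg
    intro g a
    obtain ⟨b, hb, hb'⟩ := Pall g a
    rw [sl2Act_eq hb]
    exact hb'

/-- The chain rule for a derivation applied to a polynomial expression. -/
lemma derivation_aeval {ι B : Type*} [Fintype ι] [CommRing B] [Algebra ℂ B]
    (D : Derivation ℂ B B) (f : ι → B) (p : MvPolynomial ι ℂ) :
    D (aeval f p) = ∑ i, aeval f (pderiv i p) * D (f i) := by
  classical
  induction p using MvPolynomial.induction_on with
  | C c => simp
  | add p q hp hq => simp only [map_add, hp, hq, add_mul, Finset.sum_add_distrib]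
  | mul_X p j hp =>
    simp only [map_mul, aeval_X, Derivation.leibniz, hp, smul_eq_mul, pderiv_X, map_add, add_mul,
      Finset.sum_add_distrib, Finset.mul_sum, Pi.single_apply]
    simp [mul_comm, mul_left_comm, apply_ite]

/-- A polynomial is constant along the integral curves of a derivation iff it is killed by it. -/
lemma eval_curve_iff (D : Derivation ℂ (MvPolynomial (Fin 7) ℂ) (MvPolynomial (Fin 7) ℂ))
    (curve : (Fin 7 → ℂ) → Fin 7 → Polynomial ℂ)
    (h0 : ∀ a i, (curve a i).eval 0 = a i)
    (hD : ∀ a i, Polynomial.derivative (curve a i) = aeval (curve a) (D (X i)))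
    (p : MvPolynomial (Fin 7) ℂ) :
    (∀ s a, eval (fun i => (curve a i).eval s) p = eval a p) ↔ D p = 0 := by
  have hev (s a q) : (aeval (curve a) q).eval s = eval (fun i => (curve a i).eval s) q := by
    rw [← Polynomial.coe_aeval_eq_eval, ← AlgHom.comp_apply, comp_aeval, ← coe_aeval_eq_eval]
    rfl
  have hder (a) : Polynomial.derivative (aeval (curve a) p) = aeval (curve a) (D p) := by
    have h1 : D p = ∑ i, pderiv i p * D (X i) := by simpa using derivation_aeval D X p
    have h2 := derivation_aeval Polynomial.derivative' (curve a) p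
    rw [h1, map_sum]
    simp only [map_mul, ← hD]
    exact h2
  constructor
  · intro h
    refine MvPolynomial.funext fun a => ?_
    have hc : aeval (curve a) p = Polynomial.C (eval a p) :=
      Polynomial.funext fun s => by rw [hev, h, Polynomial.eval_C]
    have := hder a
    rw [hc, Polynomial.derivative_C] at this
    have h2 := hev 0 a (D p)
    rw [← this, Polynomial.eval_zero] at h2
    simp only [h0] at h2
    rw [map_zero]
    exact h2.symm
  · intro h s a
    have h1 := hder a
    rw [h, map_zero] at h1
    have h2 := Polynomial.eq_C_of_derivative_eq_zero h1
    have h3 : eval a p = (aeval (curve a) p).eval 0 := by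
      rw [hev]; simp only [h0]
    rw [← hev, h3, h2, Polynomial.eval_C, Polynomial.eval_C]

lemma mem_invariantRing_iff_raise_lower {p : MvPolynomial (Fin 7) ℂ} :
    p ∈ invariantRing 6 ↔ raise p = 0 ∧ lower p = 0 := by
  have c2 : (Polynomial.C (2 : ℂ)) = 2 := map_ofNat Polynomial.C 2
  have c3 : (Polynomial.C (3 : ℂ)) = 3 := map_ofNat Polynomial.C 3
  have c4 : (Polynomial.C (4 : ℂ)) = 4 := map_ofNat Polynomial.C 4
  have c5 : (Polynomial.C (5 : ℂ)) = 5 := map_ofNat Polynomial.C 5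
  have c6 : (Polynomial.C (6 : ℂ)) = 6 := map_ofNat Polynomial.C 6
  rw [mem_invariantRing_iff]
  refine and_congr ?_ ?_
  · rw [← eval_curve_iff raise (fun a => actUpper Polynomial.X fun i => Polynomial.C (a i))]
    · refine forall₂_congr fun s a => ?_
      have : (fun i => (actUpper Polynomial.X (fun i => Polynomial.C (a i)) i).eval s)
          = actUpper s a := by
        ext i
        fin_cases i <;> simp [actUpper] <;> ring
      rw [this]
    · intro a i
      fin_cases i <;> simp [actUpper]
    · intro a i
      rw [raise_X]
      fin_cases i <;> simp [actUpper, Polynomial.smul_eq_C_mul, c2, c3, c4, c5, c6, -mul_eq_mul_right_iff,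
        -mul_eq_mul_left_iff] <;> ring
  · rw [← eval_curve_iff lower (fun a => actLower Polynomial.X fun i => Polynomial.C (a i))]
    · refine forall₂_congr fun s a => ?_
      have : (fun i => (actLower Polynomial.X (fun i => Polynomial.C (a i)) i).eval s)
          = actLower s a := by
        ext i
        fin_cases i <;> simp [actLower] <;> ring
      rw [this]
    · intro a i
      fin_cases i <;> simp [actLower]
    · intro a i
      rw [lower_X]
      fin_cases i <;> simp [actLower, Polynomial.smul_eq_C_mul, c2, c3, c4, c5, c6, -mul_eq_mul_right_iff,
        -mul_eq_mul_left_iff] <;> ring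

lemma mem_weightSpace_of_mem_invariantRing {p : MvPolynomial (Fin 7) ℂ}
    (hp : p ∈ invariantRing 6) {d : ℕ} (hd : p.IsHomogeneous d) : p ∈ weightSpace d 0 := by
  obtain ⟨h1, h2⟩ := mem_invariantRing_iff_raise_lower.1 hp
  refine mem_weightSpace.2 fun m hm => ⟨?_, ?_⟩
  · have := hd hm
    have h2 : Finsupp.degree m = d := by rw [Finsupp.degree_eq_weight_one]; exact this
    exact_mod_cast h2
  · have := coeff_raise_lower_sub m p
    rw [h1, h2, map_zero, map_zero, sub_zero, coeff_zero] at this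
    have h3 : (expWeight m : ℂ) = 0 := by
      rcases mul_eq_zero.1 this.symm with h | h
      · simpa using h
      · exact absurd h hm
    exact_mod_cast h3

end Action

section Covariants

variable {R : Type*} [CommRing R]

/-- The coefficients of a sextic, rescaled by binomial coefficients. -/
def scaledCoeff (a : Fin 7 → R) : Fin 7 → R :=
  ![60 * a 0, 10 * a 1, 4 * a 2, 3 * a 3, 4 * a 4, 10 * a 5, 60 * a 6]

/-- The quartic covariant of degree two of a sextic. -/
def quarticCov (b : Fin 7 → R) : Fin 5 → R :=
  ![6 * (b 0 * b 4 - 4 * (b 1 * b 3) + 3 * (b 2 * b 2)),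
    3 * (b 0 * b 5 - 3 * (b 1 * b 4) + 2 * (b 2 * b 3)),
    b 0 * b 6 - 9 * (b 2 * b 4) + 8 * (b 3 * b 3),
    3 * (b 1 * b 6 - 3 * (b 2 * b 5) + 2 * (b 3 * b 4)),
    6 * (b 2 * b 6 - 4 * (b 3 * b 5) + 3 * (b 4 * b 4))]

/-- The quadratic covariant obtained by pairing a sextic with a quartic. -/
def quadraticCov (b : Fin 7 → R) (j : Fin 5 → R) : Fin 3 → R :=
  ![b 0 * j 4 - 4 * (b 1 * j 3) + 6 * (b 2 * j 2) - 4 * (b 3 * j 1) + b 4 * j 0,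
    b 1 * j 4 - 4 * (b 2 * j 3) + 6 * (b 3 * j 2) - 4 * (b 4 * j 1) + b 5 * j 0,
    b 2 * j 4 - 4 * (b 3 * j 3) + 6 * (b 4 * j 2) - 4 * (b 5 * j 1) + b 6 * j 0]

/-- The quadratic covariant obtained by pairing a quartic with a quadratic form. -/
def quarticPairing (j : Fin 5 → R) (l : Fin 3 → R) : Fin 3 → R :=
  ![j 0 * l 2 - 2 * (j 1 * l 1) + j 2 * l 0, j 1 * l 2 - 2 * (j 2 * l 1) + j 3 * l 0,
    j 2 * l 2 - 2 * (j 3 * l 1) + j 4 * l 0]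

/-- The quadratic invariant of a sextic. -/
def sexticInv (b : Fin 7 → R) : R :=
  b 0 * b 6 - 6 * (b 1 * b 5) + 15 * (b 2 * b 4) - 10 * (b 3 * b 3)

/-- The quadratic invariant of a quartic. -/
def quarticInv (j : Fin 5 → R) : R := j 0 * j 4 - 4 * (j 1 * j 3) + 3 * (j 2 * j 2)

/-- The discriminant of a quadratic form. -/
def quadraticInv (l : Fin 3 → R) : R := l 0 * l 2 - l 1 * l 1

/-- The joint determinant of three quadratic forms. -/
def detInv (l m n : Fin 3 → R) : R :=
  l 0 * (m 1 * n 2) - l 0 * (m 2 * n 1) - l 1 * (m 0 * n 2) + l 1 * (m 2 * n 0)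
    + l 2 * (m 0 * n 1) - l 2 * (m 1 * n 0)

variable {B : Type*} [CommRing B] [Algebra ℂ B]

/-- The derivation `D` acts on the coefficients of a binary form as `u` times the raising operator
plus `v` times the lowering operator. -/
def ActsOnForm (D : Derivation ℂ B B) (u v : B) {n : ℕ} (b : Fin (n + 1) → B) : Prop :=
  ∀ k : Fin (n + 1), D (b k) = u * (k : ℕ) * b (k - 1) + v * ((n - (k : ℕ) : ℕ) : B) * b (k + 1)

variable {D : Derivation ℂ B B} {u v : B}

lemma actsOnForm_sextic {b : Fin 7 → B} : ActsOnForm D u v b ↔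
    D (b 0) = v * 6 * b 1 ∧ D (b 1) = u * b 0 + v * 5 * b 2 ∧
      D (b 2) = u * 2 * b 1 + v * 4 * b 3 ∧ D (b 3) = u * 3 * b 2 + v * 3 * b 4 ∧
      D (b 4) = u * 4 * b 3 + v * 2 * b 5 ∧ D (b 5) = u * 5 * b 4 + v * b 6 ∧
      D (b 6) = u * 6 * b 5 := by
  simp [ActsOnForm, Fin.forall_fin_succ, Fin.succ]
  norm_num

lemma actsOnForm_quartic {b : Fin 5 → B} : ActsOnForm D u v b ↔
    D (b 0) = v * 4 * b 1 ∧ D (b 1) = u * b 0 + v * 3 * b 2 ∧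
      D (b 2) = u * 2 * b 1 + v * 2 * b 3 ∧ D (b 3) = u * 3 * b 2 + v * b 4 ∧
      D (b 4) = u * 4 * b 3 := by
  simp [ActsOnForm, Fin.forall_fin_succ, Fin.succ]
  norm_num

lemma actsOnForm_quadratic {b : Fin 3 → B} : ActsOnForm D u v b ↔
    D (b 0) = v * 2 * b 1 ∧ D (b 1) = u * b 0 + v * b 2 ∧ D (b 2) = u * 2 * b 1 := by
  simp [ActsOnForm, Fin.forall_fin_succ, Fin.succ]
  norm_num

lemma derivation_ofNat (n : ℕ) [n.AtLeastTwo] : D ofNat(n) = 0 := by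
  rw [← Nat.cast_ofNat (R := B), D.map_natCast]

lemma ActsOnForm.quarticCov {b : Fin 7 → B} (h : ActsOnForm D u v b) :
    ActsOnForm D u v (quarticCov b) := by
  obtain ⟨h0, h1, h2, h3, h4, h5, h6⟩ := actsOnForm_sextic.1 h
  refine actsOnForm_quartic.2 ⟨?_, ?_, ?_, ?_, ?_⟩ <;>
    simp [BinarySextic.quarticCov, derivation_ofNat, D.leibniz, h0, h1, h2, h3, h4, h5, h6] <;>
    ring

lemma ActsOnForm.quadraticCov {b : Fin 7 → B} (h : ActsOnForm D u v b) {j : Fin 5 → B}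
    (hj : ActsOnForm D u v j) : ActsOnForm D u v (quadraticCov b j) := by
  obtain ⟨h0, h1, h2, h3, h4, h5, h6⟩ := actsOnForm_sextic.1 h
  obtain ⟨g0, g1, g2, g3, g4⟩ := actsOnForm_quartic.1 hj
  refine actsOnForm_quadratic.2 ⟨?_, ?_, ?_⟩ <;>
    simp [BinarySextic.quadraticCov, derivation_ofNat, D.leibniz, h0, h1, h2, h3, h4, h5, h6,
      g0, g1, g2, g3, g4] <;> ring

lemma ActsOnForm.quarticPairing {j : Fin 5 → B} (hj : ActsOnForm D u v j) {l : Fin 3 → B}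
    (hl : ActsOnForm D u v l) : ActsOnForm D u v (quarticPairing j l) := by
  obtain ⟨h0, h1, h2⟩ := actsOnForm_quadratic.1 hl
  obtain ⟨g0, g1, g2, g3, g4⟩ := actsOnForm_quartic.1 hj
  refine actsOnForm_quadratic.2 ⟨?_, ?_, ?_⟩ <;>
    simp [BinarySextic.quarticPairing, derivation_ofNat, D.leibniz, h0, h1, h2,
      g0, g1, g2, g3, g4] <;> ring

lemma ActsOnForm.sexticInv {b : Fin 7 → B} (h : ActsOnForm D u v b) : D (sexticInv b) = 0 := by
  obtain ⟨h0, h1, h2, h3, h4, h5, h6⟩ := actsOnForm_sextic.1 h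
  simp [BinarySextic.sexticInv, derivation_ofNat, D.leibniz, h0, h1, h2, h3, h4, h5, h6]
  ring

lemma ActsOnForm.quarticInv {j : Fin 5 → B} (h : ActsOnForm D u v j) : D (quarticInv j) = 0 := by
  obtain ⟨h0, h1, h2, h3, h4⟩ := actsOnForm_quartic.1 h
  simp [BinarySextic.quarticInv, derivation_ofNat, D.leibniz, h0, h1, h2, h3, h4]
  ring

lemma ActsOnForm.quadraticInv {l : Fin 3 → B} (h : ActsOnForm D u v l) :
    D (quadraticInv l) = 0 := by
  obtain ⟨h0, h1, h2⟩ := actsOnForm_quadratic.1 h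
  simp [BinarySextic.quadraticInv, D.leibniz, h0, h1, h2]
  ring

lemma ActsOnForm.detInv {l m n : Fin 3 → B} (hl : ActsOnForm D u v l) (hm : ActsOnForm D u v m)
    (hn : ActsOnForm D u v n) : D (detInv l m n) = 0 := by
  obtain ⟨h0, h1, h2⟩ := actsOnForm_quadratic.1 hl
  obtain ⟨g0, g1, g2⟩ := actsOnForm_quadratic.1 hm
  obtain ⟨k0, k1, k2⟩ := actsOnForm_quadratic.1 hn
  simp [BinarySextic.detInv, D.leibniz, h0, h1, h2, g0, g1, g2, k0, k1, k2]
  ring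

end Covariants

section Homogeneous

variable {σ : Type*} {d e : ℕ}

lemma isHomogeneous_ofNat_mul (n : ℕ) [n.AtLeastTwo] {p : MvPolynomial σ ℂ}
    (hp : p.IsHomogeneous d) : (OfNat.ofNat n * p).IsHomogeneous d := by
  have := (isHomogeneous_C σ (OfNat.ofNat n : ℂ)).mul hp
  rwa [zero_add, map_ofNat] at this

lemma isHomogeneous_scaledCoeff (k : Fin 7) :
    (scaledCoeff (X : Fin 7 → MvPolynomial (Fin 7) ℂ) k).IsHomogeneous 1 := by
  fin_cases k <;> exact isHomogeneous_ofNat_mul _ (isHomogeneous_X _ _)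

lemma isHomogeneous_quarticCov {b : Fin 7 → MvPolynomial σ ℂ} (hb : ∀ k, (b k).IsHomogeneous d)
    (k : Fin 5) : (quarticCov b k).IsHomogeneous (d + d) := by
  have h (i j) : (b i * b j).IsHomogeneous (d + d) := (hb i).mul (hb j)
  have h' (n : ℕ) [n.AtLeastTwo] (i j) : (OfNat.ofNat n * (b i * b j)).IsHomogeneous (d + d) :=
    isHomogeneous_ofNat_mul n (h i j)
  fin_cases k
  · exact isHomogeneous_ofNat_mul _ (((h _ _).sub (h' _ _ _)).add (h' _ _ _))
  · exact isHomogeneous_ofNat_mul _ (((h _ _).sub (h' _ _ _)).add (h' _ _ _))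
  · exact ((h _ _).sub (h' _ _ _)).add (h' _ _ _)
  · exact isHomogeneous_ofNat_mul _ (((h _ _).sub (h' _ _ _)).add (h' _ _ _))
  · exact isHomogeneous_ofNat_mul _ (((h _ _).sub (h' _ _ _)).add (h' _ _ _))

lemma isHomogeneous_quadraticCov {b : Fin 7 → MvPolynomial σ ℂ} (hb : ∀ k, (b k).IsHomogeneous d)
    {j : Fin 5 → MvPolynomial σ ℂ} (hj : ∀ k, (j k).IsHomogeneous e) (k : Fin 3) :
    (quadraticCov b j k).IsHomogeneous (d + e) := by
  have h (i k) : (b i * j k).IsHomogeneous (d + e) := (hb i).mul (hj k)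
  have h' (n : ℕ) [n.AtLeastTwo] (i k) : (OfNat.ofNat n * (b i * j k)).IsHomogeneous (d + e) :=
    isHomogeneous_ofNat_mul n (h i k)
  fin_cases k <;>
    exact ((((h _ _).sub (h' _ _ _)).add (h' _ _ _)).sub (h' _ _ _)).add (h _ _)

lemma isHomogeneous_quarticPairing {j : Fin 5 → MvPolynomial σ ℂ}
    (hj : ∀ k, (j k).IsHomogeneous d) {l : Fin 3 → MvPolynomial σ ℂ}
    (hl : ∀ k, (l k).IsHomogeneous e) (k : Fin 3) :
    (quarticPairing j l k).IsHomogeneous (d + e) := by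
  have h (i k) : (j i * l k).IsHomogeneous (d + e) := (hj i).mul (hl k)
  have h' (n : ℕ) [n.AtLeastTwo] (i k) : (OfNat.ofNat n * (j i * l k)).IsHomogeneous (d + e) :=
    isHomogeneous_ofNat_mul n (h i k)
  fin_cases k <;> exact ((h _ _).sub (h' _ _ _)).add (h _ _)

lemma isHomogeneous_sexticInv {b : Fin 7 → MvPolynomial σ ℂ} (hb : ∀ k, (b k).IsHomogeneous d) :
    (sexticInv b).IsHomogeneous (d + d) := by
  have h (i j) : (b i * b j).IsHomogeneous (d + d) := (hb i).mul (hb j)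
  have h' (n : ℕ) [n.AtLeastTwo] (i j) : (OfNat.ofNat n * (b i * b j)).IsHomogeneous (d + d) :=
    isHomogeneous_ofNat_mul n (h i j)
  exact (((h _ _).sub (h' _ _ _)).add (h' _ _ _)).sub (h' _ _ _)

lemma isHomogeneous_quarticInv {b : Fin 5 → MvPolynomial σ ℂ} (hb : ∀ k, (b k).IsHomogeneous d) :
    (quarticInv b).IsHomogeneous (d + d) := by
  have h (i j) : (b i * b j).IsHomogeneous (d + d) := (hb i).mul (hb j)
  have h' (n : ℕ) [n.AtLeastTwo] (i j) : (OfNat.ofNat n * (b i * b j)).IsHomogeneous (d + d) :=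
    isHomogeneous_ofNat_mul n (h i j)
  exact ((h _ _).sub (h' _ _ _)).add (h' _ _ _)

lemma isHomogeneous_quadraticInv {b : Fin 3 → MvPolynomial σ ℂ}
    (hb : ∀ k, (b k).IsHomogeneous d) : (quadraticInv b).IsHomogeneous (d + d) :=
  ((hb _).mul (hb _)).sub ((hb _).mul (hb _))

lemma isHomogeneous_detInv {d e f : ℕ} {l m n : Fin 3 → MvPolynomial σ ℂ}
    (hl : ∀ k, (l k).IsHomogeneous d) (hm : ∀ k, (m k).IsHomogeneous e)
    (hn : ∀ k, (n k).IsHomogeneous f) : (detInv l m n).IsHomogeneous (d + (e + f)) := by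
  have h (i j k) : (l i * (m j * n k)).IsHomogeneous (d + (e + f)) :=
    (hl i).mul ((hm j).mul (hn k))
  exact (((((h _ _ _).sub (h _ _ _)).sub (h _ _ _)).add (h _ _ _)).add (h _ _ _)).sub (h _ _ _)

end Homogeneous

section Invariants

variable {R S : Type*} [CommRing R] [CommRing S]

/-- The quartic covariant as a function of the coefficients of a sextic. -/
def covJ (a : Fin 7 → R) : Fin 5 → R := quarticCov (scaledCoeff a)

/-- The quadratic covariant of degree three of a sextic. -/
def covL (a : Fin 7 → R) : Fin 3 → R := quadraticCov (scaledCoeff a) (covJ a)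

/-- The quadratic covariant of degree five of a sextic. -/
def covM (a : Fin 7 → R) : Fin 3 → R := quarticPairing (covJ a) (covL a)

/-- The quadratic covariant of degree seven of a sextic. -/
def covN (a : Fin 7 → R) : Fin 3 → R := quarticPairing (covJ a) (covM a)

/-- The four basic invariants of even degree of a sextic. -/
def evenInv (a : Fin 7 → R) : Fin 4 → R :=
  ![sexticInv (scaledCoeff a), quarticInv (covJ a), quadraticInv (covL a), quadraticInv (covM a)]

/-- The basic invariant of degree fifteen of a sextic. -/
def oddInv (a : Fin 7 → R) : R := detInv (covL a) (covM a) (covN a)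

lemma map_scaledCoeff (f : R →+* S) (a : Fin 7 → R) (k : Fin 7) :
    f (scaledCoeff a k) = scaledCoeff (fun i => f (a i)) k := by
  fin_cases k <;> simp [scaledCoeff, map_ofNat f]

lemma map_quarticCov (f : R →+* S) (a : Fin 7 → R) (k : Fin 5) :
    f (quarticCov a k) = quarticCov (fun i => f (a i)) k := by
  fin_cases k <;> simp [quarticCov, map_ofNat f]

lemma map_quadraticCov (f : R →+* S) (a : Fin 7 → R) (j : Fin 5 → R) (k : Fin 3) :
    f (quadraticCov a j k) = quadraticCov (fun i => f (a i)) (fun i => f (j i)) k := by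
  fin_cases k <;> simp [quadraticCov, map_ofNat f]

lemma map_quarticPairing (f : R →+* S) (j : Fin 5 → R) (l : Fin 3 → R) (k : Fin 3) :
    f (quarticPairing j l k) = quarticPairing (fun i => f (j i)) (fun i => f (l i)) k := by
  fin_cases k <;> simp [quarticPairing, map_ofNat f]

lemma map_covJ (f : R →+* S) (a : Fin 7 → R) (k : Fin 5) :
    f (covJ a k) = covJ (fun i => f (a i)) k := by
  simp only [covJ, map_quarticCov, map_scaledCoeff]

lemma map_covL (f : R →+* S) (a : Fin 7 → R) (k : Fin 3) :
    f (covL a k) = covL (fun i => f (a i)) k := by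
  simp only [covL, map_quadraticCov, map_covJ, map_scaledCoeff]

lemma map_covM (f : R →+* S) (a : Fin 7 → R) (k : Fin 3) :
    f (covM a k) = covM (fun i => f (a i)) k := by
  simp only [covM, map_quarticPairing, map_covJ, map_covL]

lemma map_covN (f : R →+* S) (a : Fin 7 → R) (k : Fin 3) :
    f (covN a k) = covN (fun i => f (a i)) k := by
  simp only [covN, map_quarticPairing, map_covJ, map_covM]

lemma map_evenInv (f : R →+* S) (a : Fin 7 → R) (k : Fin 4) :
    f (evenInv a k) = evenInv (fun i => f (a i)) k := by
  fin_cases k <;> simp [evenInv, sexticInv, quarticInv, quadraticInv, map_covJ, map_covL, map_covM,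
    map_scaledCoeff, map_ofNat f]

lemma map_oddInv (f : R →+* S) (a : Fin 7 → R) :
    f (oddInv a) = oddInv (fun i => f (a i)) := by
  simp [oddInv, detInv, map_covL, map_covM, map_covN]

lemma eval_evenInv (a : Fin 7 → ℂ) (k : Fin 4) : eval a (evenInv X k) = evenInv a k := by
  simp [map_evenInv]

lemma eval_oddInv (a : Fin 7 → ℂ) : eval a (oddInv X) = oddInv a := by
  simp [map_oddInv]

section Acts

variable {B : Type*} [CommRing B] [Algebra ℂ B] {D : Derivation ℂ B B} {u v : B} {a : Fin 7 → B}

lemma ActsOnForm.evenInv (h : ActsOnForm D u v (scaledCoeff a)) (k : Fin 4) :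
    D (evenInv a k) = 0 := by
  fin_cases k
  · exact h.sexticInv
  · exact h.quarticCov.quarticInv
  · exact (h.quadraticCov h.quarticCov).quadraticInv
  · exact (h.quarticCov.quarticPairing (h.quadraticCov h.quarticCov)).quadraticInv

lemma ActsOnForm.oddInv (h : ActsOnForm D u v (scaledCoeff a)) : D (oddInv a) = 0 :=
  have hj := h.quarticCov
  have hl := h.quadraticCov hj
  have hm := hj.quarticPairing hl
  hl.detInv hm (hj.quarticPairing hm)

end Acts

lemma actsOnForm_raise : ActsOnForm raise 1 0 (scaledCoeff X) := by
  refine actsOnForm_sextic.2 ⟨?_, ?_, ?_, ?_, ?_, ?_, ?_⟩ <;>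
    simp [scaledCoeff, raise_X, derivation_ofNat, smul_eq_C_mul, map_ofNat] <;> ring

lemma actsOnForm_lower : ActsOnForm lower 0 1 (scaledCoeff X) := by
  refine actsOnForm_sextic.2 ⟨?_, ?_, ?_, ?_, ?_, ?_, ?_⟩ <;>
    simp [scaledCoeff, lower_X, derivation_ofNat, smul_eq_C_mul, map_ofNat] <;> ring

lemma evenInv_mem (k : Fin 4) : evenInv X k ∈ invariantRing 6 :=
  mem_invariantRing_iff_raise_lower.2 ⟨actsOnForm_raise.evenInv k, actsOnForm_lower.evenInv k⟩

lemma oddInv_mem : oddInv X ∈ invariantRing 6 :=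
  mem_invariantRing_iff_raise_lower.2 ⟨actsOnForm_raise.oddInv, actsOnForm_lower.oddInv⟩

lemma isHomogeneous_evenInv (k : Fin 4) :
    (evenInv (X : Fin 7 → MvPolynomial (Fin 7) ℂ) k).IsHomogeneous (basicDeg k) := by
  have hj := isHomogeneous_quarticCov isHomogeneous_scaledCoeff
  have hl := isHomogeneous_quadraticCov isHomogeneous_scaledCoeff hj
  have hm := isHomogeneous_quarticPairing hj hl
  fin_cases k
  · exact isHomogeneous_sexticInv isHomogeneous_scaledCoeff
  · exact isHomogeneous_quarticInv hj
  · exact isHomogeneous_quadraticInv hl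
  · exact isHomogeneous_quadraticInv hm

lemma isHomogeneous_oddInv :
    (oddInv (X : Fin 7 → MvPolynomial (Fin 7) ℂ)).IsHomogeneous 15 := by
  have hj := isHomogeneous_quarticCov isHomogeneous_scaledCoeff
  have hl := isHomogeneous_quadraticCov isHomogeneous_scaledCoeff hj
  have hm := isHomogeneous_quarticPairing hj hl
  exact isHomogeneous_detInv hl hm (isHomogeneous_quarticPairing hj hm)

section Values

lemma evenInv_pointSix :
    evenInv (![0, 1, 0, 0, 1, 0, 0] : Fin 7 → ℂ) = ![0, 0, -74649600, 0] := by
  ext k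
  fin_cases k <;>
  simp [evenInv, sexticInv, quarticInv, quadraticInv, covJ, covL, covM, scaledCoeff,
    quarticCov, quadraticCov, quarticPairing] <;> norm_num

lemma evenInv_pointTen :
    evenInv (![0, 1, 0, 0, 0, 0, 1] : Fin 7 → ℂ) = ![0, 0, 0, -16796160000000000] := by
  ext k
  fin_cases k <;>
  simp [evenInv, sexticInv, quarticInv, quadraticInv, covJ, covL, covM, scaledCoeff,
    quarticCov, quadraticCov, quarticPairing] <;> norm_num

lemma oddInv_pointSix : oddInv (![0, 1, 0, 0, 1, 0, 0] : Fin 7 → ℂ) ≠ 0 := by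
  simp [oddInv, detInv, covJ, covL, covM, covN, scaledCoeff,
    quarticCov, quadraticCov, quarticPairing]
  norm_num

lemma oddInv_pointTen : oddInv (![0, 1, 0, 0, 0, 0, 1] : Fin 7 → ℂ) ≠ 0 := by
  simp [oddInv, detInv, covJ, covL, covM, covN, scaledCoeff,
    quarticCov, quadraticCov, quarticPairing]

end Values

end Invariants

section Independence

lemma eval_derivation_evenInv {D : Derivation ℂ (MvPolynomial (Fin 7) ℂ) (MvPolynomial (Fin 7) ℂ)}
    {P : Fin 7 → ℂ} (hP : P = ![0, 1, 0, 0, 0, 0, 1]) (h0 : eval P (D (X 0)) = 0)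
    (h1 : eval P (D (X 1)) = 0) (h2 : eval P (D (X 2)) = 0) (k : Fin 4) :
    eval P (D (evenInv X k)) = ![-600 * eval P (D (X 5)), 2592000 * eval P (D (X 4)),
      4665600000 * eval P (D (X 3)), -67184640000000000 * eval P (D (X 6))] k := by
  have b k : eval P (scaledCoeff X k) = ![0, 10, 0, 0, 0, 0, 60] k := by
    subst hP
    fin_cases k <;> simp [scaledCoeff]
  have b' k : eval P (D (scaledCoeff X k)) = ![0, 0, 0, 3 * eval P (D (X 3)),
      4 * eval P (D (X 4)), 10 * eval P (D (X 5)), 60 * eval P (D (X 6))] k := by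
    fin_cases k <;> simp [scaledCoeff, derivation_ofNat, h0, h1, h2]
  generalize eval P (D (X 3)) = x3 at *
  generalize eval P (D (X 4)) = x4 at *
  generalize eval P (D (X 5)) = x5 at *
  generalize eval P (D (X 6)) = x6 at *
  have j k : eval P (covJ X k) = ![0, 0, 0, 1800, 0] k := by
    fin_cases k <;> simp [covJ, quarticCov, b] <;> norm_num
  have j' k : eval P (D (covJ X k)) = ![-720 * x3, -360 * x4, 0, 1800 * x6, 0] k := by
    fin_cases k <;> simp [covJ, quarticCov, derivation_ofNat, D.leibniz, b, b'] <;> ring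
  have l k : eval P (covL X k) = ![-72000, 0, 0] k := by
    fin_cases k <;> simp [covL, quadraticCov, b, j] <;> norm_num
  have l' k : eval P (D (covL X k)) = ![-72000 * x6, 0, -64800 * x3] k := by
    fin_cases k <;> simp [covL, quadraticCov, derivation_ofNat, D.leibniz, b, b', j, j'] <;> ring
  have m k : eval P (covM X k) = ![0, -129600000, 0] k := by
    fin_cases k <;> simp [covM, quarticPairing, j, l] <;> norm_num
  have m' k : eval P (D (covM X k)) = ![0, -259200000 * x6, 0] k := by
    fin_cases k <;> simp [covM, quarticPairing, derivation_ofNat, D.leibniz, j, j', l, l'] <;> ring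
  fin_cases k
  · simp [evenInv, sexticInv, derivation_ofNat, D.leibniz, b, b']; ring
  · simp [evenInv, quarticInv, derivation_ofNat, D.leibniz, j, j']; ring
  · simp [evenInv, quadraticInv, D.leibniz, l, l']; ring
  · simp [evenInv, quadraticInv, D.leibniz, m, m']; ring

/-- The Jacobian criterion for algebraic independence. -/
lemma algebraicIndependent_of_jacobian {ι κ : Type*} [Fintype ι] [DecidableEq ι]
    {f : ι → MvPolynomial κ ℂ} {D : ι → Derivation ℂ (MvPolynomial κ ℂ) (MvPolynomial κ ℂ)}
    {O P : κ → ℂ} (hO : ∀ k, eval O (f k) = 0)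
    (hdet : (Matrix.of fun i k => eval P (D i (f k))).det ≠ 0) : AlgebraicIndependent ℂ f := by
  have hdet' : (Matrix.of fun i k => D i (f k)).det ≠ 0 := by
    intro h
    have h2 := congrArg (eval P) h
    rw [RingHom.map_det, map_zero] at h2
    exact hdet h2
  have key (G : MvPolynomial ι ℂ) (hG : aeval f G = 0) (k : ι) : aeval f (pderiv k G) = 0 := by
    have h : (Matrix.of fun i k => D i (f k)).mulVec (fun k => aeval f (pderiv k G)) = 0 := by
      ext1 i
      have := derivation_aeval (D i) f G
      rw [hG, map_zero] at this
      simpa [Matrix.mulVec, dotProduct, mul_comm] using this.symm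
    exact congrFun (Matrix.eq_zero_of_mulVec_eq_zero hdet' h) k
  have main (n : ℕ) : ∀ m : ι →₀ ℕ, m.degree = n → ∀ G : MvPolynomial ι ℂ, aeval f G = 0 →
      coeff m G = 0 := by
    induction n with
    | zero =>
      intro m hm G hG
      rw [Finsupp.degree_eq_zero_iff] at hm
      have h2 := congrArg (eval O) hG
      rw [map_zero, ← coe_aeval_eq_eval, RingHom.coe_coe, ← AlgHom.comp_apply, comp_aeval] at h2
      have h3 (k) : aeval O (f k) = 0 := hO k
      simp only [h3] at h2
      rw [hm, ← constantCoeff_eq, ← eval_zero]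
      exact h2
    | succ n ih =>
      intro m hm G hG
      obtain ⟨i, hi⟩ : ∃ i, m i ≠ 0 := by
        by_contra! h
        have : m = 0 := Finsupp.ext h
        simp [this] at hm
      have hs : m - Finsupp.single i 1 + Finsupp.single i 1 = m :=
        tsub_add_cancel_of_le (by simpa [Nat.one_le_iff_ne_zero] using hi)
      have h1 := coeff_pderiv (i := i) G (m - Finsupp.single i 1)
      rw [hs, ih (m - Finsupp.single i 1) _ _ (key G hG i)] at h1
      · exact (mul_eq_zero.1 h1.symm).resolve_right (Nat.cast_add_one_ne_zero _)
      · have h2 := congrArg Finsupp.degree hs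
        rw [map_add, Finsupp.degree_single, hm] at h2
        omega
  rw [algebraicIndependent_iff]
  intro G hG
  ext m
  rw [main _ m rfl G hG, coeff_zero]

lemma algebraicIndependent_evenInv :
    AlgebraicIndependent ℂ (evenInv (X : Fin 7 → MvPolynomial (Fin 7) ℂ)) := by
  refine algebraicIndependent_of_jacobian (D := fun i => pderiv (![5, 4, 3, 6] i)) (O := 0)
    (P := ![0, 1, 0, 0, 0, 0, 1]) (fun k => ?_) ?_
  · rw [eval_zero, constantCoeff_eq]
    refine (isHomogeneous_evenInv k).coeff_eq_zero ?_
    fin_cases k <;> simp [basicDeg]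
  · have h : (Matrix.of fun i k => eval ![0, 1, 0, 0, 0, 0, 1]
        (pderiv (![5, 4, 3, 6] i) (evenInv (X : Fin 7 → MvPolynomial (Fin 7) ℂ) k)))
        = Matrix.diagonal ![-600, 2592000, 4665600000, -67184640000000000] := by
      ext i k
      rw [Matrix.of_apply, eval_derivation_evenInv rfl] <;> fin_cases i <;>
        simp [pderiv_X, Matrix.diagonal] <;> fin_cases k <;> simp
    rw [h, Matrix.det_diagonal]
    simp [Fin.prod_univ_succ]

end Independence

section Generation

/-- The polynomial expressions in the four basic invariants of even degree. -/
def evenMap : MvPolynomial (Fin 4) ℂ →ₐ[ℂ] MvPolynomial (Fin 7) ℂ := aeval (evenInv X)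

lemma evenMap_injective : Function.Injective evenMap := algebraicIndependent_evenInv

lemma evenMap_mem (G : MvPolynomial (Fin 4) ℂ) : evenMap G ∈ invariantRing 6 := by
  have : (invariantRing 6).val.comp (aeval fun k => ⟨evenInv X k, evenInv_mem k⟩) = evenMap := by
    ext1 k
    simp [evenMap]
  rw [← this]
  exact Subtype.property _

lemma evenMap_monomial (m : Fin 4 →₀ ℕ) (c : ℂ) :
    evenMap (monomial m c) = C c * m.prod fun k e => evenInv X k ^ e := by
  rw [evenMap, aeval_monomial, algebraMap_eq]

lemma isHomogeneous_evenMap {G : MvPolynomial (Fin 4) ℂ} {d : ℕ}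
    (hG : IsWeightedHomogeneous basicDeg G d) : (evenMap G).IsHomogeneous d := by
  rw [G.as_sum, map_sum]
  refine IsHomogeneous.sum _ _ _ fun m hm => ?_
  rw [evenMap_monomial, ← hG (mem_support_iff.1 hm), Finsupp.weight_apply, Finsupp.prod,
    Finsupp.sum, ← zero_add (Finset.sum _ _)]
  refine (isHomogeneous_C _ _).mul (IsHomogeneous.prod _ _ _ fun k _ => ?_)
  have := (isHomogeneous_evenInv k).pow (m k)
  rwa [mul_comm] at this

/-- The exponent vector of a monomial in the basic invariants. -/
def expOf (l : Fin 4 →₀ ℕ) : Fin 4 →₀ ℕ := Finsupp.equivFunOnFinite.symm fun i => l i / basicDeg i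

lemma weight_expOf {d : ℕ} {l : Fin 4 →₀ ℕ} (hl : l ∈ basicExps d) :
    Finsupp.weight basicDeg (expOf l) = d := by
  rw [basicExps, Finset.mem_filter, Finset.mem_finsuppAntidiag] at hl
  rw [Finsupp.weight_apply, Finsupp.sum_fintype _ _ (by simp), ← hl.1.1]
  refine Finset.sum_congr rfl fun i _ => ?_
  exact Nat.div_mul_cancel (hl.2 i)

lemma expOf_injective (d : ℕ) : Function.Injective fun l : basicExps d => expOf l := by
  rintro ⟨l, hl⟩ ⟨l', hl'⟩ h
  rw [basicExps, Finset.mem_filter] at hl hl'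
  ext i
  have := DFunLike.congr_fun h i
  have h2 : l i / basicDeg i = l' i / basicDeg i := this
  show l i = l' i
  rw [← Nat.div_mul_cancel (hl.2 i), h2, Nat.div_mul_cancel (hl'.2 i)]

lemma linearIndependent_monomials (d : ℕ) :
    LinearIndependent ℂ fun l : basicExps d => evenMap (monomial (expOf l) 1) := by
  have h := (basisMonomials (Fin 4) ℂ).linearIndependent.comp _ (expOf_injective d)
  have := h.map' evenMap.toLinearMap (LinearMap.ker_eq_bot.2 evenMap_injective)
  simpa [Function.comp_def] using this

lemma mem_span_evenMap {d : ℕ} {p : MvPolynomial (Fin 7) ℂ}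
    (h : p ∈ Submodule.span ℂ (Set.range fun l : basicExps d => evenMap (monomial (expOf l) 1))) :
    ∃ G, IsWeightedHomogeneous basicDeg G d ∧ evenMap G = p := by
  have : Submodule.span ℂ (Set.range fun l : basicExps d => evenMap (monomial (expOf l) 1))
      ≤ (weightedHomogeneousSubmodule ℂ basicDeg d).map evenMap.toLinearMap := by
    rw [Submodule.span_le]
    rintro _ ⟨l, rfl⟩
    exact ⟨_, isWeightedHomogeneous_monomial _ _ _ (weight_expOf l.2), rfl⟩
  exact this h

lemma raise_evenMap (G : MvPolynomial (Fin 4) ℂ) : raise (evenMap G) = 0 :=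
  (mem_invariantRing_iff_raise_lower.1 (evenMap_mem G)).1

lemma oddInv_ne_zero : oddInv (X : Fin 7 → MvPolynomial (Fin 7) ℂ) ≠ 0 := by
  intro h
  have := eval_oddInv ![0, 1, 0, 0, 1, 0, 0]
  rw [h, map_zero] at this
  exact oddInv_pointSix this.symm

lemma exists_evenMap_eq {d : ℕ} (hd : Even d) {p : MvPolynomial (Fin 7) ℂ}
    (hp : p ∈ invariantRing 6) (hpd : p.IsHomogeneous d) :
    ∃ G, IsWeightedHomogeneous basicDeg G d ∧ evenMap G = p := by
  refine mem_span_evenMap (mem_span_of_raise_eq_zero ?_ _ (linearIndependent_monomials d)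
    (fun l => ?_) (fun l => raise_evenMap _) (mem_weightSpace_of_mem_invariantRing hp hpd)
    (mem_invariantRing_iff_raise_lower.1 hp).1)
  · rw [Fintype.card_coe, card_weightExps_sub_of_even hd]
  · exact mem_weightSpace_of_mem_invariantRing (evenMap_mem _)
      (isHomogeneous_evenMap (isWeightedHomogeneous_monomial _ _ _ (weight_expOf l.2)))

lemma exists_oddInv_mul_evenMap_eq {d : ℕ} (hd : Odd d) (h15 : 15 ≤ d)
    {p : MvPolynomial (Fin 7) ℂ} (hp : p ∈ invariantRing 6) (hpd : p.IsHomogeneous d) :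
    ∃ G, IsWeightedHomogeneous basicDeg G (d - 15) ∧ oddInv X * evenMap G = p := by
  have hli := (linearIndependent_monomials (d - 15)).map' (LinearMap.mulLeft ℂ (oddInv X))
    (LinearMap.ker_eq_bot.2 (mul_right_injective₀ oddInv_ne_zero))
  have hs : p ∈ Submodule.span ℂ (Set.range
      (LinearMap.mulLeft ℂ (oddInv X) ∘
        fun l : basicExps (d - 15) => evenMap (monomial (expOf l) 1))) := by
    refine mem_span_of_raise_eq_zero ?_ _ hli
      (fun l => ?_) (fun l => ?_) (mem_weightSpace_of_mem_invariantRing hp hpd)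
      (mem_invariantRing_iff_raise_lower.1 hp).1
    · rw [Fintype.card_coe, card_weightExps_sub_of_odd hd h15]
    · refine mem_weightSpace_of_mem_invariantRing (mul_mem oddInv_mem (evenMap_mem _)) ?_
      have := isHomogeneous_oddInv.mul (isHomogeneous_evenMap
        (isWeightedHomogeneous_monomial _ _ (1 : ℂ) (weight_expOf l.2)))
      rwa [Nat.add_sub_cancel' h15] at this
    · exact (mem_invariantRing_iff_raise_lower.1 (mul_mem oddInv_mem (evenMap_mem _))).1
  rw [Set.range_comp, ← Submodule.map_span] at hs
  obtain ⟨q, hq, rfl⟩ := hs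
  obtain ⟨G, hG, rfl⟩ := mem_span_evenMap hq
  exact ⟨G, hG, rfl⟩

lemma eq_zero_of_odd_of_lt {d : ℕ} (hd : Odd d) (h15 : d < 15)
    {p : MvPolynomial (Fin 7) ℂ} (hp : p ∈ invariantRing 6) (hpd : p.IsHomogeneous d) : p = 0 := by
  have := mem_span_of_raise_eq_zero (ι := Empty) (d := d)
    (by rw [card_weightExps_sub_of_odd_of_lt hd h15]; rfl) (fun e => e.elim)
    (linearIndependent_empty_type) (fun e => e.elim) (fun e => e.elim)
    (mem_weightSpace_of_mem_invariantRing hp hpd) (mem_invariantRing_iff_raise_lower.1 hp).1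
  rwa [Set.range_eq_empty, Submodule.span_empty, Submodule.mem_bot] at this

/-- The expression of the square of the odd basic invariant in the even basic invariants. -/
lemma exists_evenMap_eq_oddInv_sq : ∃ F, IsWeightedHomogeneous basicDeg F 30 ∧
    evenMap F = oddInv X ^ 2 ∧ (∃ c : ℂ, eval ![0, 0, c, 0] F ≠ 0) ∧
      ∃ c : ℂ, eval ![0, 0, 0, c] F ≠ 0 := by
  obtain ⟨F, hF, hF2⟩ := exists_evenMap_eq (d := 30) (by decide) (pow_mem oddInv_mem 2)
    (isHomogeneous_oddInv.pow 2)
  have key (a : Fin 7 → ℂ) : eval (evenInv a) F = oddInv a ^ 2 := by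
    have h := congrArg (aeval a) hF2
    rw [evenMap, ← AlgHom.comp_apply, comp_aeval] at h
    have h1 (k) : aeval a (evenInv (X : Fin 7 → MvPolynomial (Fin 7) ℂ) k) = evenInv a k :=
      eval_evenInv a k
    have h2 : aeval a (oddInv (X : Fin 7 → MvPolynomial (Fin 7) ℂ)) = oddInv a := eval_oddInv a
    rw [map_pow, h2] at h
    simp only [h1] at h
    exact h
  refine ⟨F, hF, hF2, ⟨-74649600, ?_⟩, ⟨-16796160000000000, ?_⟩⟩
  · rw [← evenInv_pointSix, key]
    exact pow_ne_zero 2 oddInv_pointSix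
  · rw [← evenInv_pointTen, key]
    exact pow_ne_zero 2 oddInv_pointTen

lemma isHomogeneous_derivation
    {D : Derivation ℂ (MvPolynomial (Fin 7) ℂ) (MvPolynomial (Fin 7) ℂ)}
    (hD : ∀ i, (D (X i)).IsHomogeneous 1) {p : MvPolynomial (Fin 7) ℂ} {d : ℕ}
    (hp : p.IsHomogeneous d) : (D p).IsHomogeneous d := by
  have h : D p = ∑ i, pderiv i p * D (X i) := by simpa using derivation_aeval D X p
  rw [h]
  refine IsHomogeneous.sum _ _ _ fun i _ => ?_
  rcases Nat.eq_zero_or_pos d with rfl | hd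
  · rw [← totalDegree_zero_iff_isHomogeneous, totalDegree_eq_zero_iff_eq_C] at hp
    rw [hp, pderiv_C, zero_mul]
    exact isHomogeneous_zero _ _ _
  · have := (hp.pderiv (i := i)).mul (hD i)
    rwa [Nat.sub_add_cancel hd] at this

lemma derivation_homogeneousComponent
    {D : Derivation ℂ (MvPolynomial (Fin 7) ℂ) (MvPolynomial (Fin 7) ℂ)}
    (hD : ∀ i, (D (X i)).IsHomogeneous 1) {p : MvPolynomial (Fin 7) ℂ} (hp : D p = 0) (d : ℕ) :
    D (homogeneousComponent d p) = 0 := by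
  have h := congrArg (homogeneousComponent d) hp
  rw [← sum_homogeneousComponent p, map_sum, map_sum, map_zero] at h
  by_cases hd : d ∈ Finset.range (p.totalDegree + 1)
  · rw [Finset.sum_eq_single d] at h
    · rwa [homogeneousComponent_of_mem (n := d) (isHomogeneous_derivation hD
        (homogeneousComponent_isHomogeneous d p)), if_pos rfl] at h
    · intro e _ he
      rw [homogeneousComponent_of_mem (n := e) (isHomogeneous_derivation hD
        (homogeneousComponent_isHomogeneous e p)), if_neg he.symm]
    · exact fun h => absurd hd h
  · rw [homogeneousComponent_eq_zero _ _ (by simpa using hd), map_zero]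

lemma homogeneousComponent_mem {p : MvPolynomial (Fin 7) ℂ} (hp : p ∈ invariantRing 6) (d : ℕ) :
    homogeneousComponent d p ∈ invariantRing 6 := by
  obtain ⟨h1, h2⟩ := mem_invariantRing_iff_raise_lower.1 hp
  refine mem_invariantRing_iff_raise_lower.2 ⟨derivation_homogeneousComponent (fun i => ?_) h1 d,
    derivation_homogeneousComponent (fun i => ?_) h2 d⟩
  · rw [raise_X]
    fin_cases i
    · exact isHomogeneous_zero _ _ _
    all_goals first | exact isHomogeneous_X _ _ |
      exact (homogeneousSubmodule _ _ 1).smul_mem _ (isHomogeneous_X _ _)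
  · rw [lower_X]
    fin_cases i
    on_goal 7 => exact isHomogeneous_zero _ _ _
    all_goals first | exact isHomogeneous_X _ _ |
      exact (homogeneousSubmodule _ _ 1).smul_mem _ (isHomogeneous_X _ _)

lemma exists_evenMap_add {p : MvPolynomial (Fin 7) ℂ} (hp : p ∈ invariantRing 6) :
    ∃ G H, p = evenMap G + oddInv X * evenMap H := by
  rw [← sum_homogeneousComponent p]
  refine Finset.sum_induction _ (fun q => ∃ G H, q = evenMap G + oddInv X * evenMap H) ?_ ?_ ?_
  · rintro _ _ ⟨G, H, rfl⟩ ⟨G', H', rfl⟩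
    exact ⟨G + G', H + H', by simp only [map_add]; ring⟩
  · exact ⟨0, 0, by simp⟩
  · intro d _
    have h1 := homogeneousComponent_mem hp d
    have h2 := homogeneousComponent_isHomogeneous d p
    rcases Nat.even_or_odd d with hd | hd
    · obtain ⟨G, -, hG⟩ := exists_evenMap_eq hd h1 h2
      exact ⟨G, 0, by simp [hG]⟩
    · rcases lt_or_ge d 15 with h15 | h15
      · exact ⟨0, 0, by simp [eq_zero_of_odd_of_lt hd h15 h1 h2]⟩
      · obtain ⟨G, -, hG⟩ := exists_oddInv_mul_evenMap_eq hd h15 h1 h2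
        exact ⟨0, G, by simp [hG]⟩

end Generation

section Integral

variable {A B : Type*} [CommRing A] [Algebra ℂ A] [CommRing B] [Algebra ℂ B]
  {ι κ : Type*} {g : κ → A} {x : A}

/-- `IntegralOver g x` says that `x` is integral over the subalgebra generated by the `g k`. -/
def IntegralOver (g : κ → A) (x : A) : Prop := IsIntegral (Algebra.adjoin ℂ (Set.range g)) x

lemma integralOver_iff : IntegralOver g x ↔
    (aeval g : MvPolynomial κ ℂ →ₐ[ℂ] A).toRingHom.IsIntegralElem x := by
  have hmem (q : MvPolynomial κ ℂ) : aeval g q ∈ Algebra.adjoin ℂ (Set.range g) := by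
    rw [Algebra.adjoin_range_eq_range_aeval]
    exact ⟨q, rfl⟩
  let f : MvPolynomial κ ℂ →+* Algebra.adjoin ℂ (Set.range g) :=
    ((aeval g).codRestrict _ hmem).toRingHom
  have hf : Function.Surjective f := by
    rintro ⟨y, hy⟩
    have h2 := hy
    rw [Algebra.adjoin_range_eq_range_aeval] at h2
    obtain ⟨q, rfl⟩ := h2
    exact ⟨q, rfl⟩
  constructor
  · rintro ⟨p, hp, hp0⟩
    obtain ⟨q, hq, -, hqm⟩ := Polynomial.lifts_and_natDegree_eq_and_monic
      ((Polynomial.lifts_iff_coeff_lifts (f := f) p).2 fun n => hf _) hp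
    refine ⟨q, hqm, ?_⟩
    rw [← hq, Polynomial.eval₂_map] at hp0
    exact hp0
  · rintro ⟨p, hp, hp0⟩
    refine ⟨p.map f, hp.map f, ?_⟩
    rw [Polynomial.eval₂_map]
    exact hp0

lemma aeval_comp_toRingHom (g : κ → A) (φ : A →ₐ[ℂ] B) :
    (aeval (fun k => φ (g k)) : MvPolynomial κ ℂ →ₐ[ℂ] B).toRingHom =
      φ.toRingHom.comp (aeval g : MvPolynomial κ ℂ →ₐ[ℂ] A).toRingHom := by
  ext <;> simp

lemma IntegralOver.map (h : IntegralOver g x) (φ : A →ₐ[ℂ] B) :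
    IntegralOver (fun k => φ (g k)) (φ x) := by
  obtain ⟨p, hp, hp0⟩ := integralOver_iff.1 h
  refine integralOver_iff.2 ⟨p, hp, ?_⟩
  rw [aeval_comp_toRingHom]
  exact (Polynomial.hom_eval₂ p _ φ.toRingHom x).symm.trans ((congrArg φ hp0).trans (map_zero φ))

lemma IntegralOver.of_map {φ : A →ₐ[ℂ] B} (hφ : Function.Injective φ)
    (h : IntegralOver (fun k => φ (g k)) (φ x)) : IntegralOver g x := by
  obtain ⟨p, hp, hp0⟩ := integralOver_iff.1 h
  refine integralOver_iff.2 ⟨p, hp, hφ ?_⟩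
  rw [aeval_comp_toRingHom] at hp0
  exact (Polynomial.hom_eval₂ p _ φ.toRingHom x).trans (hp0.trans (map_zero φ).symm)

lemma IntegralOver.trans {h : ι → A} (hg : ∀ k, IntegralOver h (g k)) (hx : IntegralOver g x) :
    IntegralOver h x := by
  let C := integralClosure (Algebra.adjoin ℂ (Set.range h)) A
  have hle : Algebra.adjoin ℂ (Set.range g) ≤ C.restrictScalars ℂ :=
    Algebra.adjoin_le (by rintro _ ⟨k, rfl⟩; exact hg k)
  have h1 : IsIntegral C x := by
    obtain ⟨p, hp, hp0⟩ := hx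
    let f : Algebra.adjoin ℂ (Set.range g) →+* C := (Subalgebra.inclusion hle).toRingHom
    refine ⟨p.map f, hp.map f, ?_⟩
    rw [Polynomial.eval₂_map]
    exact hp0
  exact isIntegral_trans x h1

lemma card_le_of_integralOver [IsDomain A] [Fintype ι] [Fintype κ] {f : ι → A}
    (hf : AlgebraicIndependent ℂ f) (h : ∀ i, IntegralOver g (f i)) :
    Fintype.card ι ≤ Fintype.card κ := by
  classical
  have hind := AlgebraicIndependent.matroid_indep_iff.2 hf.to_subtype_range
  have hsub : Set.range f ⊆ (AlgebraicIndependent.matroid ℂ A).closure (Set.range g) := by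
    rw [AlgebraicIndependent.matroid_closure_eq]
    rintro _ ⟨i, rfl⟩
    exact (h i).isAlgebraic
  have h1 := hind.encard_le_eRk_of_subset hsub
  rw [Matroid.eRk_closure_eq] at h1
  have h2 := h1.trans (Matroid.eRk_le_encard _ _)
  have h3 : (Set.range f).encard = Fintype.card ι := by
    rw [← Set.image_univ, hf.injective.encard_image]; simp
  have h4 : (Set.range g).encard ≤ Fintype.card κ := by
    rw [← Set.image_univ]
    exact (Set.encard_image_le g Set.univ).trans (by simp)
  exact_mod_cast h3 ▸ h2.trans h4

/-- Generators that vanish do not contribute. -/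
lemma card_add_card_zero_le [IsDomain A] [Fintype ι] [Fintype κ] [DecidablePred fun k => g k = 0]
    {f : ι → A} (hf : AlgebraicIndependent ℂ f) (h : ∀ i, IntegralOver g (f i)) :
    Fintype.card ι + (Finset.univ.filter fun k => g k = 0).card ≤ Fintype.card κ := by
  have h1 := card_le_of_integralOver (g := fun k : {k // g k ≠ 0} => g k) hf fun i =>
    (h i).trans fun k => by
      by_cases hk : g k = 0
      · rw [hk]
        exact isIntegral_zero
      · exact isIntegral_algebraMap (x := (⟨g k, Algebra.subset_adjoin ⟨⟨k, hk⟩, rfl⟩⟩ :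
          Algebra.adjoin ℂ (Set.range fun k : {k // g k ≠ 0} => g k)))
  rw [Fintype.card_subtype] at h1
  have := Finset.card_filter_add_card_filter_not (s := (Finset.univ : Finset κ)) (fun k => g k = 0)
  simp only [Finset.card_univ, ne_eq] at this h1
  omega

end Integral
section EvenSextics

variable {R : Type*} [CommRing R]

/-- The sextics all of whose monomials have even exponents, restricted to a slice for the torus
action. -/
def slice (x : Fin 3 → R) : Fin 7 → R := ![x 0, 0, x 1, 0, x 2, 0, x 0]

lemma oddInv_slice (x : Fin 3 → R) : oddInv (slice x) = 0 := by
  simp [oddInv, detInv, covN, covM, covL, covJ, quarticPairing, quadraticCov, quarticCov,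
    scaledCoeff, slice]

lemma evenInv_slice_eval (k : Fin 3) :
    eval 0 (evenInv (slice (X : Fin 3 → MvPolynomial (Fin 3) ℂ)) k.castSucc) = 0 := by
  fin_cases k <;> simp [evenInv, sexticInv, quarticInv, quadraticInv, covL, covJ, quadraticCov,
    quarticCov, scaledCoeff, slice]

lemma eval_derivation_evenInv_slice
    {D : Derivation ℂ (MvPolynomial (Fin 3) ℂ) (MvPolynomial (Fin 3) ℂ)}
    {P : Fin 3 → ℂ} (hP : P = ![1, 1, 0]) {y0 y1 y2 : ℂ} (h0 : eval P (D (X 0)) = y0)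
    (h1 : eval P (D (X 1)) = y1) (h2 : eval P (D (X 2)) = y2) (k : Fin 3) :
    eval P (D (evenInv (slice X) k.castSucc)) = ![7200 * y0 + 240 * y2,
      155934720 * y0 + 1244160 * y1 - 1036800 * y2,
      11943936000 * y0 + 11943936000 * y1 + 29806755840 * y2] k := by
  have b k : eval P (scaledCoeff (slice X) k) = ![60, 0, 4, 0, 0, 0, 60] k := by
    subst hP
    fin_cases k <;> simp [scaledCoeff, slice]
  have b' k : eval P (D (scaledCoeff (slice X) k))
      = ![60 * y0, 0, 4 * y1, 0, 4 * y2, 0, 60 * y0] k := by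
    fin_cases k <;> simp [scaledCoeff, slice, derivation_ofNat, h0, h1, h2]
  have j k : eval P (covJ (slice X) k) = ![288, 0, 3600, 0, 1440] k := by
    fin_cases k <;> simp [covJ, quarticCov, b] <;> norm_num
  have j' k : eval P (D (covJ (slice X) k)) = ![576 * y1 + 1440 * y2, 0, 7200 * y0 - 144 * y2, 0,
      1440 * y0 + 1440 * y1] k := by
    fin_cases k <;> simp [covJ, quarticCov, derivation_ofNat, D.leibniz, b, b'] <;> ring
  have l k : eval P (covL (slice X) k) = ![172800, 0, 23040] k := by
    fin_cases k <;> simp [covL, quadraticCov, b, j] <;> norm_num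
  have l' k : eval P (D (covL (slice X) k)) = ![345600 * y0 + 172800 * y1 - 2304 * y2, 0,
      23040 * y0 + 46080 * y1 + 172800 * y2] k := by
    fin_cases k <;> simp [covL, quadraticCov, derivation_ofNat, D.leibniz, b, b', j, j'] <;> ring
  fin_cases k
  · simp [evenInv, sexticInv, derivation_ofNat, D.leibniz, b, b']; ring
  · simp [evenInv, quarticInv, derivation_ofNat, D.leibniz, j, j']; ring
  · simp [evenInv, quadraticInv, D.leibniz, l, l']; ring

lemma algebraicIndependent_evenInv_slice : AlgebraicIndependent ℂ
    fun k : Fin 3 => evenInv (slice (X : Fin 3 → MvPolynomial (Fin 3) ℂ)) k.castSucc := by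
  refine algebraicIndependent_of_jacobian (D := fun i => pderiv i) (O := 0)
    (P := ![1, 1, 0]) evenInv_slice_eval ?_
  have h : (Matrix.of fun i k => eval ![1, 1, 0]
      (pderiv i (evenInv (slice (X : Fin 3 → MvPolynomial (Fin 3) ℂ)) (Fin.castSucc k))))
      = !![7200, 155934720, 11943936000; 0, 1244160, 11943936000;
        240, -1036800, 29806755840] := by
    ext i k
    rw [Matrix.of_apply, eval_derivation_evenInv_slice rfl rfl rfl rfl]
    fin_cases i <;> simp [pderiv_X]
  rw [h, Matrix.det_fin_three]
  simp
  norm_num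

end EvenSextics

section Restriction

/-- The projection onto the polynomial ring in the variables of `S`. -/
def restrictVars (S : Finset (Fin 4)) : MvPolynomial (Fin 4) ℂ →ₐ[ℂ] MvPolynomial S ℂ :=
  aeval fun i => if h : i ∈ S then X ⟨i, h⟩ else 0

/-- No monomial in the variables of `S` has weighted degree `d`. -/
def NoMonomial (S : Finset (Fin 4)) (d : ℕ) : Prop :=
  ∀ m : Fin 4 → ℕ, (∀ i ∉ S, m i = 0) → 2 * m 0 + 4 * m 1 + 6 * m 2 + 10 * m 3 ≠ d

lemma weight_basicDeg (m : Fin 4 →₀ ℕ) :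
    Finsupp.weight basicDeg m = 2 * m 0 + 4 * m 1 + 6 * m 2 + 10 * m 3 := by
  rw [Finsupp.weight_apply, Finsupp.sum_fintype _ _ (by simp)]
  simp [Fin.sum_univ_four, basicDeg, mul_comm]

lemma restrictVars_eq_zero {S : Finset (Fin 4)} {d : ℕ} (h : NoMonomial S d)
    {G : MvPolynomial (Fin 4) ℂ} (hG : IsWeightedHomogeneous basicDeg G d) :
    restrictVars S G = 0 := by
  rw [G.as_sum, map_sum]
  refine Finset.sum_eq_zero fun m hm => ?_
  have hw := hG (mem_support_iff.1 hm)
  rw [weight_basicDeg] at hw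
  obtain ⟨i, hi, hmi⟩ : ∃ i ∉ S, m i ≠ 0 := by
    by_contra! hc
    exact h m hc hw
  rw [restrictVars, aeval_monomial, Finsupp.prod_fintype _ _ (by simp),
    Finset.prod_eq_zero (Finset.mem_univ i), mul_zero]
  simp [hi, hmi]

end Restriction

section Necessity

/-- The possible shapes of the square of an invariant of degree `d`, written in the basic
invariants of even degree. -/
inductive IsSquareOfDegree (d : ℕ) : MvPolynomial (Fin 4) ℂ → Prop
  | even {G} (hd : Even d) (hG : IsWeightedHomogeneous basicDeg G d) : IsSquareOfDegree d (G ^ 2)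
  | odd {F H} (hd : Odd d) (h15 : 15 ≤ d) (hF : IsWeightedHomogeneous basicDeg F 30)
      (hF2 : evenMap F = oddInv X ^ 2) (hH : IsWeightedHomogeneous basicDeg H (d - 15)) :
      IsSquareOfDegree d (F * H ^ 2)
  | zero (hd : Odd d) (h15 : d < 15) : IsSquareOfDegree d 0

lemma exists_isSquareOfDegree {p : MvPolynomial (Fin 7) ℂ} {d : ℕ} (hp : p ∈ invariantRing 6)
    (hpd : p.IsHomogeneous d) : ∃ q, IsSquareOfDegree d q ∧ evenMap q = p ^ 2 := by
  rcases Nat.even_or_odd d with hd | hd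
  · obtain ⟨G, hG, rfl⟩ := exists_evenMap_eq hd hp hpd
    exact ⟨_, .even hd hG, map_pow _ _ _⟩
  · rcases le_or_gt 15 d with h15 | h15
    · obtain ⟨H, hH, rfl⟩ := exists_oddInv_mul_evenMap_eq hd h15 hp hpd
      obtain ⟨F, hF, hF2, -⟩ := exists_evenMap_eq_oddInv_sq
      exact ⟨_, .odd hd h15 hF hF2 hH, by rw [map_mul, map_pow, hF2, mul_pow]⟩
    · exact ⟨0, .zero hd h15, by simp [eq_zero_of_odd_of_lt hd h15 hp hpd]⟩

lemma IsSquareOfDegree.restrictVars_eq_zero {d : ℕ} {q : MvPolynomial (Fin 4) ℂ}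
    (hq : IsSquareOfDegree d q) {S : Finset (Fin 4)} (he : Even d → NoMonomial S d)
    (ho : Odd d → 15 ≤ d → NoMonomial S 30 ∨ NoMonomial S (d - 15)) : restrictVars S q = 0 := by
  cases hq with
  | even hd hG => simp [BinarySextic.restrictVars_eq_zero (he hd) hG]
  | odd hd h15 hF hF2 hH =>
    rcases ho hd h15 with h | h
    · simp [BinarySextic.restrictVars_eq_zero h hF]
    · simp [BinarySextic.restrictVars_eq_zero h hH]
  | zero => simp

lemma IsSquareOfDegree.aeval_evenInv_slice {d : ℕ} {q : MvPolynomial (Fin 4) ℂ}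
    (hq : IsSquareOfDegree d q) (hd : Odd d) :
    aeval (evenInv (slice (X : Fin 3 → MvPolynomial (Fin 3) ℂ))) q = 0 := by
  cases hq with
  | even he => exact absurd hd (Nat.not_odd_iff_even.2 he)
  | @odd F H _ h15 hF hF2 hH =>
    have h := congrArg (aeval (slice (X : Fin 3 → MvPolynomial (Fin 3) ℂ))) hF2
    have h1 k : aeval (slice (X : Fin 3 → MvPolynomial (Fin 3) ℂ))
        (evenInv (X : Fin 7 → MvPolynomial (Fin 7) ℂ) k) = evenInv (slice X) k := by
      rw [← RingHom.coe_coe, map_evenInv]; simp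
    have h2 : aeval (slice (X : Fin 3 → MvPolynomial (Fin 3) ℂ))
        (oddInv (X : Fin 7 → MvPolynomial (Fin 7) ℂ)) = 0 := by
      rw [← RingHom.coe_coe, map_oddInv]; simpa using oddInv_slice _
    rw [evenMap, ← AlgHom.comp_apply, comp_aeval, map_pow, h2] at h
    simp only [h1] at h
    rw [map_mul, h.trans (zero_pow two_ne_zero), zero_mul]
  | zero => simp

variable {d : Fin 4 → ℕ} {p : Fin 4 → invariantRing 6}

lemma exists_integralOver_of_isHSOP (h : IsHSOP 6 d p) : ∃ q : Fin 4 → MvPolynomial (Fin 4) ℂ,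
    (∀ k, IsSquareOfDegree (d k) (q k)) ∧ ∀ i, IntegralOver q (X i) := by
  obtain ⟨-, h1, -, h2⟩ := h
  choose q hq hqp using fun k => exists_isSquareOfDegree (p k).2 (h1 k)
  refine ⟨q, hq, fun i => ?_⟩
  have h3 : IntegralOver (fun k => p k ^ 2) (⟨evenInv X i, evenInv_mem i⟩ : invariantRing 6) := by
    refine IntegralOver.trans (g := p) (fun k => ?_) (Algebra.IsIntegral.isIntegral _)
    exact IsIntegral.of_pow two_pos (isIntegral_algebraMap (x := (⟨p k ^ 2,
      Algebra.subset_adjoin ⟨k, rfl⟩⟩ : Algebra.adjoin ℂ (Set.range fun k => p k ^ 2))))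
  refine IntegralOver.of_map evenMap_injective ?_
  convert h3.map (invariantRing 6).val using 2 with k
  · simp [hqp]
  · simp [evenMap]

lemma card_add_card_le_of_isHSOP (h : IsHSOP 6 d p) (S : Finset (Fin 4)) (T : Finset (Fin 4))
    (hT : ∀ k ∈ T, (Even (d k) → NoMonomial S (d k)) ∧
      (Odd (d k) → 15 ≤ d k → NoMonomial S 30 ∨ NoMonomial S (d k - 15))) :
    S.card + T.card ≤ 4 := by
  classical
  obtain ⟨q, hq, hX⟩ := exists_integralOver_of_isHSOP h
  have h1 := card_add_card_zero_le (g := fun k => restrictVars S (q k))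
    (MvPolynomial.algebraicIndependent_X S ℂ) fun i => by
      convert (hX i).map (restrictVars S)
      simp [restrictVars]
  have h2 : T ⊆ Finset.univ.filter fun k => restrictVars S (q k) = 0 := fun k hk =>
    Finset.mem_filter.2 ⟨Finset.mem_univ _, (hq k).restrictVars_eq_zero (hT k hk).1 (hT k hk).2⟩
  have := Finset.card_le_card h2
  simp only [Fintype.card_coe, Fintype.card_fin] at h1
  omega

lemma card_odd_le_of_isHSOP (h : IsHSOP 6 d p) :
    (Finset.univ.filter fun k => ¬ 2 ∣ d k).card ≤ 1 := by
  classical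
  obtain ⟨q, hq, hX⟩ := exists_integralOver_of_isHSOP h
  have h1 := card_add_card_zero_le
    (g := fun k => aeval (evenInv (slice (X : Fin 3 → MvPolynomial (Fin 3) ℂ))) (q k))
    algebraicIndependent_evenInv_slice fun i => by
      convert (hX i.castSucc).map (aeval (evenInv (slice (X : Fin 3 → MvPolynomial (Fin 3) ℂ))))
      simp
  have h2 : (Finset.univ.filter fun k => ¬ 2 ∣ d k) ⊆ Finset.univ.filter fun k =>
      aeval (evenInv (slice (X : Fin 3 → MvPolynomial (Fin 3) ℂ))) (q k) = 0 := fun k hk =>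
    Finset.mem_filter.2 ⟨Finset.mem_univ _, (hq k).aeval_evenInv_slice
      (by simpa [Nat.odd_iff, Nat.dvd_iff_mod_eq_zero] using hk)⟩
  have := Finset.card_le_card h2
  simp only [Fintype.card_fin] at h1
  omega

/-- The combinatorial conditions on degree sequences. -/
def Admissible (d : Fin 4 → ℕ) : Prop :=
  (∀ k, d k ∉ ({1, 3, 5, 7, 9, 11, 13} : Set ℕ)) ∧
    (Finset.univ.filter fun k => d k ∈ ({2, 17} : Finset ℕ)).card ≤ 1 ∧
    (Finset.univ.filter fun k =>
      d k ∈ ({2, 4, 8, 14, 17, 19, 23, 29} : Finset ℕ)).card ≤ 2 ∧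
    (Finset.univ.filter fun k => d k ∈ ({2, 6, 17, 21} : Finset ℕ)).card ≤ 2 ∧
    3 ≤ (Finset.univ.filter fun k => 2 ∣ d k).card ∧
    (∃ k, 3 ∣ d k) ∧ (∃ k, 4 ∣ d k) ∧ (∃ k, 5 ∣ d k)

theorem admissible_of_isHSOP (h : IsHSOP 6 d p) : Admissible d := by
  have key := card_add_card_le_of_isHSOP h
  refine ⟨fun k hk => ?_, ?_, ?_, ?_, ?_, ?_, ?_, ?_⟩
  · have := key Finset.univ {k} fun j hj => by
      rw [Finset.mem_singleton.1 hj]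
      simp only [Set.mem_insert_iff, Set.mem_singleton_iff] at hk
      refine ⟨fun he => ?_, fun ho h15 => ?_⟩
      · rw [Nat.even_iff] at he
        omega
      · omega
    simp at this
  · have := key {1, 2, 3} (Finset.univ.filter fun k => d k ∈ ({2, 17} : Finset ℕ)) fun j hj => by
      simp only [Finset.mem_filter, Finset.mem_univ, true_and, Finset.mem_insert,
        Finset.mem_singleton] at hj
      refine ⟨fun he m hm => ?_, fun ho h15 => Or.inr fun m hm => ?_⟩
      · have := hm 0 (by decide)
        rw [Nat.even_iff] at he
        omega
      · have := hm 0 (by decide)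
        omega
    have hc : ({1, 2, 3} : Finset (Fin 4)).card = 3 := rfl
    omega
  · have := key {2, 3} (Finset.univ.filter fun k =>
        d k ∈ ({2, 4, 8, 14, 17, 19, 23, 29} : Finset ℕ)) fun j hj => by
      simp only [Finset.mem_filter, Finset.mem_univ, true_and, Finset.mem_insert,
        Finset.mem_singleton] at hj
      refine ⟨fun he m hm => ?_, fun ho h15 => Or.inr fun m hm => ?_⟩
      · have := hm 0 (by decide)
        have := hm 1 (by decide)
        rw [Nat.even_iff] at he
        omega
      · have := hm 0 (by decide)
        have := hm 1 (by decide)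
        omega
    have hc : ({2, 3} : Finset (Fin 4)).card = 2 := rfl
    omega
  · have := key {1, 3} (Finset.univ.filter fun k => d k ∈ ({2, 6, 17, 21} : Finset ℕ)) fun j hj => by
      simp only [Finset.mem_filter, Finset.mem_univ, true_and, Finset.mem_insert,
        Finset.mem_singleton] at hj
      refine ⟨fun he m hm => ?_, fun ho h15 => Or.inr fun m hm => ?_⟩
      · have := hm 0 (by decide)
        have := hm 2 (by decide)
        rw [Nat.even_iff] at he
        omega
      · have := hm 0 (by decide)
        have := hm 2 (by decide)
        omega
    have hc : ({1, 3} : Finset (Fin 4)).card = 2 := rfl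
    omega
  · have h1 := card_odd_le_of_isHSOP h
    have := Finset.card_filter_add_card_filter_not (s := (Finset.univ : Finset (Fin 4)))
      (fun k => 2 ∣ d k)
    simp only [Finset.card_univ, Fintype.card_fin] at this
    omega
  · by_contra! hc
    have := key {2} Finset.univ fun j _ => by
      refine ⟨fun he m hm => ?_, fun ho h15 => Or.inr fun m hm => ?_⟩ <;>
      · have := hm 0 (by decide)
        have := hm 1 (by decide)
        have := hm 3 (by decide)
        have := hc j
        omega
    simp at this
  · by_contra! hc
    have := key {1} Finset.univ fun j _ => by
      refine ⟨fun he m hm => ?_, fun ho h15 => Or.inl fun m hm => ?_⟩ <;>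
      · have := hm 0 (by decide)
        have := hm 2 (by decide)
        have := hm 3 (by decide)
        have := hc j
        omega
    simp at this
  · by_contra! hc
    have := key {3} Finset.univ fun j _ => by
      refine ⟨fun he m hm => ?_, fun ho h15 => Or.inr fun m hm => ?_⟩ <;>
      · have := hm 0 (by decide)
        have := hm 1 (by decide)
        have := hm 2 (by decide)
        have := hc j
        omega
    simp at this

end Necessity

section Avoidance

variable {Q : Type*} [CommRing Q] [Algebra ℂ Q] {ι : Type*} [Fintype ι] [DecidableEq ι]

lemma exists_mem_forall_notMem {V : Submodule ℂ Q} {B : Set (Ideal Q)} (hB : B.Finite)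
    (h : ∀ P ∈ B, ¬ V ≤ P.restrictScalars ℂ) : ∃ v ∈ V, ∀ P ∈ B, v ∉ P := by
  by_contra! hc
  have := hB.to_subtype
  obtain ⟨P, hP⟩ := Subspace.exists_eq_top_of_iUnion_eq_univ
    (p := fun P : B => (P.1.restrictScalars ℂ).comap V.subtype) (by
      rw [Set.eq_univ_iff_forall]
      intro v
      obtain ⟨P, hP, hv⟩ := hc v v.2
      exact Set.mem_iUnion.2 ⟨⟨P, hP⟩, hv⟩)
  refine h P P.2 fun v hv => ?_
  have : (⟨v, hv⟩ : V) ∈ (P.1.restrictScalars ℂ).comap V.subtype := hP ▸ trivial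
  exact this

open Classical in
/-- If every prime ideal contains at most as many of the subspaces `V j` as its height, then one
can choose an element in each `V j` such that they generate an ideal of maximal height. -/
lemma exists_forall_card_le_height [IsNoetherianRing Q] (V : ι → Submodule ℂ Q)
    (hV : ∀ P : Ideal Q, P.IsPrime →
      ((Finset.univ.filter fun j => V j ≤ P.restrictScalars ℂ).card : ℕ∞) ≤ P.height) :
    ∃ p : ι → Q, (∀ j, p j ∈ V j) ∧
      ∀ P : Ideal Q, P.IsPrime → (∀ j, p j ∈ P) → (Fintype.card ι : ℕ∞) ≤ P.height := by
  suffices key : ∀ T : Finset ι, ∃ p : ι → Q, (∀ j, p j ∈ V j) ∧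
      ∀ P : Ideal Q, P.IsPrime → (∀ j ∈ T, p j ∈ P) →
        ((T.card + (Tᶜ.filter fun j => V j ≤ P.restrictScalars ℂ).card : ℕ) : ℕ∞) ≤ P.height by
    obtain ⟨p, hp, h⟩ := key Finset.univ
    exact ⟨p, hp, fun P hP hj => by simpa using h P hP fun j _ => hj j⟩
  intro T
  induction T using Finset.induction_on with
  | empty =>
    exact ⟨fun _ => 0, fun j => zero_mem _, fun P hP _ => by simpa using hV P hP⟩
  | insert i T hi ih =>
    obtain ⟨p, hp, h⟩ := ih
    let I (M : Finset ι) : Ideal Q :=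
      Ideal.span (p '' T ∪ ⋃ j ∈ M, (V j : Set Q))
    let B : Set (Ideal Q) :=
      {P | ¬ V i ≤ P.restrictScalars ℂ ∧ P ∈ ⋃ M : Finset ι, (I M).minimalPrimes}
    have hB : B.Finite := (Set.finite_iUnion fun M =>
      (I M).finite_minimalPrimes_of_isNoetherianRing).subset fun P hP => hP.2
    obtain ⟨v, hv, hvB⟩ := exists_mem_forall_notMem (V := V i) hB fun P hP => hP.1
    refine ⟨Function.update p i v, fun j => ?_, fun P hP hj => ?_⟩
    · by_cases hji : j = i
      · subst hji
        simpa using hv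
      · simpa [hji] using hp j
    have hvP : v ∈ P := by simpa using hj i (Finset.mem_insert_self _ _)
    have hpP : ∀ j ∈ T, p j ∈ P := fun j hjT => by
      have hne : j ≠ i := fun e => hi (e ▸ hjT)
      simpa [hne] using hj j (Finset.mem_insert_of_mem hjT)
    rw [Finset.card_insert_of_notMem hi]
    set M := (insert i T)ᶜ.filter fun j => V j ≤ P.restrictScalars ℂ with hM
    have hiM : i ∉ M := by simp [hM]
    by_cases hVP : V i ≤ P.restrictScalars ℂ
    · refine le_trans ?_ (h P hP hpP)
      have : insert i M ⊆ Tᶜ.filter fun j => V j ≤ P.restrictScalars ℂ := by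
        intro j hj
        rcases Finset.mem_insert.1 hj with rfl | hj
        · simp [hi, hVP]
        · simp only [hM, Finset.mem_filter, Finset.mem_compl, Finset.mem_insert, not_or] at hj ⊢
          exact ⟨hj.1.2, hj.2⟩
      have := Finset.card_le_card this
      rw [Finset.card_insert_of_notMem hiM] at this
      exact_mod_cast (by omega)
    · have hIP : I M ≤ P := by
        refine Ideal.span_le.2 (Set.union_subset ?_ (Set.iUnion₂_subset fun j hj => ?_))
        · rintro _ ⟨j, hj, rfl⟩
          exact hpP j hj
        · exact (Finset.mem_filter.1 hj).2
      obtain ⟨P₀, hP₀, hle⟩ := Ideal.exists_minimalPrimes_le hIP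
      have := hP₀.1.1
      have hI : I M ≤ P₀ := hP₀.1.2
      have hpP₀ : ∀ j ∈ T, p j ∈ P₀ := fun j hjT =>
        hI (Ideal.subset_span (Or.inl ⟨j, hjT, rfl⟩))
      have hVP₀ : ¬ V i ≤ P₀.restrictScalars ℂ := fun hc => hVP fun x hx => hle (hc hx)
      have hvP₀ : v ∉ P₀ := hvB P₀ ⟨hVP₀, Set.mem_iUnion.2 ⟨M, hP₀⟩⟩
      have hlt : P₀ < P := lt_of_le_of_ne hle fun e => hvP₀ (e ▸ hvP)
      have hsub : M ⊆ Tᶜ.filter fun j => V j ≤ P₀.restrictScalars ℂ := by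
        intro j hj
        have hj' := hj
        simp only [hM, Finset.mem_filter, Finset.mem_compl, Finset.mem_insert, not_or] at hj ⊢
        exact ⟨hj.1.2, fun x hx =>
          hI (Ideal.subset_span (Or.inr (Set.mem_iUnion₂.2 ⟨j, hj', hx⟩)))⟩
      have h1 := Finset.card_le_card hsub
      have h2 := Ideal.height_add_one_le_of_lt_of_isPrime hlt
      refine le_trans ?_ h2
      refine le_trans ?_ (add_le_add_left (h P₀ this hpP₀) 1)
      exact_mod_cast (by omega)

end Avoidance

section VariableIdeals

variable {σ : Type*} [DecidableEq σ]

/-- The prime ideal generated by the variables in `T`. -/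
def varIdeal (T : Finset σ) : Ideal (MvPolynomial σ ℂ) :=
  RingHom.ker (aeval fun i => if i ∈ T then 0 else X i : MvPolynomial σ ℂ →ₐ[ℂ] MvPolynomial σ ℂ)

instance (T : Finset σ) : (varIdeal T).IsPrime := RingHom.ker_isPrime _

lemma X_mem_varIdeal {T : Finset σ} {i : σ} : X i ∈ varIdeal T ↔ i ∈ T := by
  rw [varIdeal, RingHom.mem_ker, aeval_X]
  split_ifs with h <;> simp [h]

lemma varIdeal_le {T : Finset σ} {P : Ideal (MvPolynomial σ ℂ)} (h : ∀ i ∈ T, X i ∈ P) :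
    varIdeal T ≤ P := by
  intro f hf
  have key : (Ideal.Quotient.mkₐ ℂ P).comp
      (aeval fun i => if i ∈ T then 0 else X i) = Ideal.Quotient.mkₐ ℂ P := by
    ext i
    by_cases hi : i ∈ T
    · simpa [hi] using ((Ideal.Quotient.eq_zero_iff_mem).2 (h i hi)).symm
    · simp [hi]
  have := DFunLike.congr_fun key f
  rw [AlgHom.comp_apply, (RingHom.mem_ker).1 hf, map_zero] at this
  exact Ideal.Quotient.eq_zero_iff_mem.1 this.symm

lemma card_le_height_varIdeal (T : Finset σ) : (T.card : ℕ∞) ≤ (varIdeal T).height := by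
  induction T using Finset.induction_on with
  | empty => simp
  | insert i T hi ih =>
    have hlt : varIdeal T < varIdeal (insert i T) := by
      refine lt_of_le_of_ne (varIdeal_le fun j hj => X_mem_varIdeal.2 (Finset.mem_insert_of_mem hj))
        fun e => hi (X_mem_varIdeal.1 (e ▸ X_mem_varIdeal.2 (Finset.mem_insert_self i T)))
    rw [Finset.card_insert_of_notMem hi]
    push_cast
    exact (add_le_add_left ih 1).trans (Ideal.height_add_one_le_of_lt_of_isPrime hlt)

lemma card_le_height {T : Finset σ} {P : Ideal (MvPolynomial σ ℂ)} [P.IsPrime]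
    (h : ∀ i ∈ T, X i ∈ P) : (T.card : ℕ∞) ≤ P.height :=
  (card_le_height_varIdeal T).trans (Ideal.height_mono (varIdeal_le h))

lemma card_add_one_le_height {T : Finset σ} {P : Ideal (MvPolynomial σ ℂ)} [P.IsPrime]
    (h : ∀ i ∈ T, X i ∈ P) (hP : P ≠ varIdeal T) : (T.card + 1 : ℕ∞) ≤ P.height :=
  (add_le_add_left (card_le_height_varIdeal T) 1).trans
    (Ideal.height_add_one_le_of_lt_of_isPrime (lt_of_le_of_ne (varIdeal_le h) hP.symm))

lemma height_varIdeal_le [Fintype σ] :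
    (varIdeal (Finset.univ : Finset σ)).height ≤ Fintype.card σ := by
  have h : varIdeal (Finset.univ : Finset σ) ∈
      (Ideal.span (Set.range (X : σ → MvPolynomial σ ℂ))).minimalPrimes := by
    refine ⟨⟨inferInstance, Ideal.span_le.2 ?_⟩, fun P hP _ => varIdeal_le fun i _ =>
      hP.2 (Ideal.subset_span ⟨i, rfl⟩)⟩
    rintro _ ⟨i, rfl⟩
    exact X_mem_varIdeal.2 (Finset.mem_univ i)
  refine (Ideal.height_le_card_of_mem_minimalPrimes_span (Set.finite_range _) h).trans ?_
  rw [← Set.image_univ, ← Nat.card_eq_fintype_card, ← Set.ncard_univ]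
  exact_mod_cast Set.ncard_image_le

end VariableIdeals

section Counting

variable {d : Fin 4 → ℕ} {S J : Finset (Fin 4)}

lemma NoMonomial.ne {e : ℕ} (h : NoMonomial S e) {a b c f : ℕ} (h0 : 0 ∈ S ∨ a = 0)
    (h1 : 1 ∈ S ∨ b = 0) (h2 : 2 ∈ S ∨ c = 0) (h3 : 3 ∈ S ∨ f = 0) :
    2 * a + 4 * b + 6 * c + 10 * f ≠ e := by
  refine h ![a, b, c, f] fun i hi => ?_
  fin_cases i
  exacts [h0.resolve_left hi, h1.resolve_left hi, h2.resolve_left hi, h3.resolve_left hi]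

lemma Admissible.fifteen_le (hd : Admissible d) {k : Fin 4} (hk : Odd (d k)) : 15 ≤ d k := by
  have := hd.1 k
  simp only [Set.mem_insert_iff, Set.mem_singleton_iff] at this
  rw [Nat.odd_iff] at hk
  omega

lemma Admissible.card_odd_le (hd : Admissible d) :
    (Finset.univ.filter fun k => ¬ 2 ∣ d k).card ≤ 1 := by
  have h1 := hd.2.2.2.2.1
  have := Finset.card_filter_add_card_filter_not (s := (Finset.univ : Finset (Fin 4)))
    (fun k => 2 ∣ d k)
  simp only [Finset.card_univ, Fintype.card_fin] at this
  omega

lemma card_le_three_of_notMem {k : Fin 4} (hk : k ∉ J) : J.card ≤ 3 := by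
  have := Finset.card_lt_univ_of_notMem hk
  simp only [Fintype.card_fin] at this
  omega

lemma Admissible.card_add_card_le (hd : Admissible d)
    (hJ : ∀ j ∈ J, (Even (d j) → NoMonomial S (d j)) ∧ (Odd (d j) → NoMonomial S (d j - 15))) :
    S.card + J.card ≤ 4 := by
  have hodd (j) := hd.fifteen_le (k := j)
  obtain ⟨-, hA, hB, hC, -, ⟨k3, h3⟩, ⟨k4, h4⟩, ⟨k5, h5⟩⟩ := hd
  have hJ' (j) (hj : j ∈ J) : ∃ e, NoMonomial S e ∧ 2 ∣ e ∧ (d j = e ∨ d j = e + 15) := by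
    rcases Nat.even_or_odd (d j) with he | ho
    · exact ⟨_, (hJ j hj).1 he, he.two_dvd, Or.inl rfl⟩
    · have := hodd j ho
      rw [Nat.odd_iff] at ho
      exact ⟨_, (hJ j hj).2 (Nat.odd_iff.2 ho), by omega, Or.inr (by omega)⟩
  have hS (T : Finset (Fin 4)) (hT : ∀ i, i ∉ T → i ∉ S) : S.card ≤ T.card :=
    Finset.card_le_card fun i hi => by_contra fun h => hT i h hi
  by_cases m0 : 0 ∈ S
  · have hJ0 : J = ∅ := by
      refine Finset.eq_empty_of_forall_notMem fun j hj => ?_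
      obtain ⟨e, he, h2, -⟩ := hJ' j hj
      exact he.ne (a := e / 2) (b := 0) (c := 0) (f := 0) (by simp [m0]) (by simp) (by simp)
        (by simp) (by omega)
    simpa [hJ0] using Finset.card_le_univ S
  by_cases m1 : 1 ∈ S <;> by_cases m2 : 2 ∈ S
  · have h1 := hS {1, 2, 3} (by intro i hi; fin_cases i <;> simp_all)
    have h2 : J ⊆ Finset.univ.filter fun k => d k ∈ ({2, 17} : Finset ℕ) := by
      intro j hj
      obtain ⟨e, he, h2, h⟩ := hJ' j hj
      have := he.ne (a := 0) (b := (e - 6 * (e % 4 / 2)) / 4) (c := e % 4 / 2) (f := 0) (by simp)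
        (by simp [m1]) (by simp [m2]) (by simp)
      simp only [Finset.mem_filter, Finset.mem_univ, true_and, Finset.mem_insert,
        Finset.mem_singleton]
      omega
    have h3 := Finset.card_le_card h2
    have hc : ({1, 2, 3} : Finset (Fin 4)).card = 3 := rfl
    omega
  · by_cases m3 : 3 ∈ S
    · have h1 := hS {1, 3} (by intro i hi; fin_cases i <;> simp_all)
      have h2 : J ⊆ Finset.univ.filter fun k => d k ∈ ({2, 6, 17, 21} : Finset ℕ) := by
        intro j hj
        obtain ⟨e, he, h2, h⟩ := hJ' j hj
        have := he.ne (a := 0) (b := (e - 10 * (e % 4 / 2)) / 4) (c := 0) (f := e % 4 / 2)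
          (by simp) (by simp [m1]) (by simp) (by simp [m3])
        simp only [Finset.mem_filter, Finset.mem_univ, true_and, Finset.mem_insert,
          Finset.mem_singleton]
        omega
      have h3 := Finset.card_le_card h2
      have hc : ({1, 3} : Finset (Fin 4)).card = 2 := rfl
      omega
    · have h1 := hS {1} (by intro i hi; fin_cases i <;> simp_all)
      have h2 : k4 ∉ J := fun hj => by
        obtain ⟨e, he, h2, h⟩ := hJ' k4 hj
        have := he.ne (a := 0) (b := e / 4) (c := 0) (f := 0)
          (by simp) (by simp [m1]) (by simp) (by simp)
        omega
      have := card_le_three_of_notMem h2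
      rw [Finset.card_singleton] at h1
      omega
  · by_cases m3 : 3 ∈ S
    · have h1 := hS {2, 3} (by intro i hi; fin_cases i <;> simp_all)
      have h2 : J ⊆ Finset.univ.filter fun k =>
          d k ∈ ({2, 4, 8, 14, 17, 19, 23, 29} : Finset ℕ) := by
        intro j hj
        obtain ⟨e, he, h2, h⟩ := hJ' j hj
        have := he.ne (a := 0) (b := 0) (c := (e - 10 * ((6 - e % 6) / 2 % 3)) / 6)
          (f := (6 - e % 6) / 2 % 3) (by simp) (by simp) (by simp [m2]) (by simp [m3])
        simp only [Finset.mem_filter, Finset.mem_univ, true_and, Finset.mem_insert,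
          Finset.mem_singleton]
        omega
      have h3 := Finset.card_le_card h2
      have hc : ({2, 3} : Finset (Fin 4)).card = 2 := rfl
      omega
    · have h1 := hS {2} (by intro i hi; fin_cases i <;> simp_all)
      have h2 : k3 ∉ J := fun hj => by
        obtain ⟨e, he, h2, h⟩ := hJ' k3 hj
        have := he.ne (a := 0) (b := 0) (c := e / 6) (f := 0)
          (by simp) (by simp) (by simp [m2]) (by simp)
        omega
      have := card_le_three_of_notMem h2
      rw [Finset.card_singleton] at h1
      omega
  · by_cases m3 : 3 ∈ S
    · have h1 := hS {3} (by intro i hi; fin_cases i <;> simp_all)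
      have h2 : k5 ∉ J := fun hj => by
        obtain ⟨e, he, h2, h⟩ := hJ' k5 hj
        have := he.ne (a := 0) (b := 0) (c := 0) (f := e / 10)
          (by simp) (by simp) (by simp) (by simp [m3])
        omega
      have := card_le_three_of_notMem h2
      rw [Finset.card_singleton] at h1
      omega
    · have h1 := hS ∅ (by intro i hi; fin_cases i <;> simp_all)
      have := Finset.card_le_univ J
      rw [Finset.card_empty] at h1
      rw [Fintype.card_fin] at this
      omega

/-- The version of `Admissible.card_add_card_le` for subspaces all of whose elements of odd degree
vanish. -/
lemma Admissible.card_add_card_le_of_even (hd : Admissible d) (h2 : 2 ∉ S) (h3 : 3 ∉ S)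
    (hJ : ∀ j ∈ J, Even (d j) → NoMonomial S (d j)) : S.card + J.card ≤ 4 := by
  have hodd := hd.card_odd_le
  obtain ⟨-, -, -, -, -, -, ⟨k4, h4⟩, -⟩ := hd
  have hS (T : Finset (Fin 4)) (hT : ∀ i, i ∉ T → i ∉ S) : S.card ≤ T.card :=
    Finset.card_le_card fun i hi => by_contra fun h => hT i h hi
  by_cases m0 : 0 ∈ S
  · have h1 := hS {0, 1} (by intro i hi; fin_cases i <;> simp_all)
    have h2 : J ⊆ Finset.univ.filter fun k => ¬ 2 ∣ d k := by
      intro j hj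
      simp only [Finset.mem_filter, Finset.mem_univ, true_and]
      intro he
      exact (hJ j hj (even_iff_two_dvd.2 he)).ne (a := d j / 2) (b := 0) (c := 0) (f := 0)
        (by simp [m0]) (by simp) (by simp) (by simp) (by omega)
    have h3 := Finset.card_le_card h2
    have hc : ({0, 1} : Finset (Fin 4)).card = 2 := rfl
    omega
  by_cases m1 : 1 ∈ S
  · have h1 := hS {1} (by intro i hi; fin_cases i <;> simp_all)
    have h2 : k4 ∉ J := fun hj => by
      exact (hJ k4 hj (even_iff_two_dvd.2 (by omega))).ne (a := 0) (b := d k4 / 4) (c := 0)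
        (f := 0) (by simp) (by simp [m1]) (by simp) (by simp) (by omega)
    have := card_le_three_of_notMem h2
    rw [Finset.card_singleton] at h1
    omega
  · have h1 := hS ∅ (by intro i hi; fin_cases i <;> simp_all)
    have := Finset.card_le_univ J
    rw [Finset.card_empty] at h1
    rw [Fintype.card_fin] at this
    omega

end Counting

section Parameters

variable {d : Fin 4 → ℕ} {F : MvPolynomial (Fin 4) ℂ}

/-- The polynomials in the basic invariants from which an invariant of degree `d` can be
constructed: those of weighted degree `d` for even `d`, and `F` times those of weighted degree
`d - 15` for odd `d`. -/
def parameterSpace (F : MvPolynomial (Fin 4) ℂ) (d : ℕ) : Submodule ℂ (MvPolynomial (Fin 4) ℂ) :=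
  if Even d then weightedHomogeneousSubmodule ℂ basicDeg d
  else (weightedHomogeneousSubmodule ℂ basicDeg (d - 15)).map (LinearMap.mulLeft ℂ F)

lemma noMonomial_of_le {P : Ideal (MvPolynomial (Fin 4) ℂ)} [P.IsPrime] {e : ℕ}
    {S : Finset (Fin 4)} (hS : ∀ i ∈ S, X i ∉ P)
    (h : weightedHomogeneousSubmodule ℂ basicDeg e ≤ P.restrictScalars ℂ) : NoMonomial S e := by
  intro m hm hw
  have h1 : monomial (Finsupp.equivFunOnFinite.symm m) 1 ∈ P :=
    h (isWeightedHomogeneous_monomial _ _ _ (by rw [weight_basicDeg]; exact hw))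
  rw [monomial_eq, C_1, one_mul, Finsupp.prod_fintype _ _ (by simp),
    Ideal.IsPrime.prod_mem_iff] at h1
  obtain ⟨i, -, hi⟩ := h1
  have hiS : i ∉ S := fun hiS => hS i hiS (Ideal.IsPrime.mem_of_pow_mem ‹_› _ hi)
  rw [show (Finsupp.equivFunOnFinite.symm m) i = 0 from hm i hiS, pow_zero] at hi
  exact Ideal.IsPrime.ne_top ‹_› ((Ideal.eq_top_iff_one P).2 hi)

lemma notMem_of_eval_ne_zero {S : Finset (Fin 4)} {x : Fin 4 → ℂ} (hF : eval x F ≠ 0)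
    (hx : ∀ i ∉ S, x i = 0) : F ∉ varIdeal Sᶜ := fun h => hF <| by
  have : varIdeal Sᶜ ≤ RingHom.ker (eval x) := varIdeal_le fun i hi => by
    rw [RingHom.mem_ker, eval_X]
    exact hx i (Finset.mem_compl.1 hi)
  exact this h

open Classical in
lemma card_parameterSpace_le_height (hd : Admissible d) (h2 : ∃ c, eval ![0, 0, c, 0] F ≠ 0)
    (h3 : ∃ c, eval ![0, 0, 0, c] F ≠ 0) (P : Ideal (MvPolynomial (Fin 4) ℂ)) (hP : P.IsPrime) :
    ((Finset.univ.filter fun j => parameterSpace F (d j) ≤ P.restrictScalars ℂ).card : ℕ∞)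
      ≤ P.height := by
  set J := Finset.univ.filter fun j => parameterSpace F (d j) ≤ P.restrictScalars ℂ with hJ
  set S := Finset.univ.filter fun i => X i ∉ P with hS
  have hSP : ∀ i ∈ S, X i ∉ P := fun i hi => (Finset.mem_filter.1 hi).2
  have hSP' : ∀ i ∈ Sᶜ, X i ∈ P := fun i hi => by simpa [hS] using hi
  have hcard : Sᶜ.card = 4 - S.card := by rw [Finset.card_compl, Fintype.card_fin]
  have heven : ∀ j ∈ J, Even (d j) → NoMonomial S (d j) := fun j hj he => by
    have := (Finset.mem_filter.1 hj).2
    rw [parameterSpace, if_pos he] at this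
    exact noMonomial_of_le hSP this
  by_cases hFP : F ∈ P
  · by_cases hPS : P = varIdeal Sᶜ
    · have hS2 : 2 ∉ S := fun h => by
        obtain ⟨c, hc⟩ := h2
        refine notMem_of_eval_ne_zero (S := S) hc (fun i hi => ?_) (hPS ▸ hFP)
        fin_cases i; exacts [rfl, rfl, absurd h hi, rfl]
      have hS3 : 3 ∉ S := fun h => by
        obtain ⟨c, hc⟩ := h3
        refine notMem_of_eval_ne_zero (S := S) hc (fun i hi => ?_) (hPS ▸ hFP)
        fin_cases i; exacts [rfl, rfl, rfl, absurd h hi]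
      have := hd.card_add_card_le_of_even hS2 hS3 heven
      refine le_trans ?_ (card_le_height hSP')
      exact_mod_cast (by omega)
    · have h4 := hd.card_add_card_le (S := S) (J := J.filter fun k => 2 ∣ d k) fun j hj => by
        rw [Finset.mem_filter] at hj
        exact ⟨heven j hj.1, fun ho =>
          absurd (even_iff_two_dvd.2 hj.2) (Nat.not_even_iff_odd.2 ho)⟩
      have h5 := Finset.card_filter_add_card_filter_not (s := J) fun k => 2 ∣ d k
      have h6 : (J.filter fun k => ¬ 2 ∣ d k).card ≤ _ :=
        Finset.card_le_card (Finset.filter_subset_filter _ (Finset.subset_univ J))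
      have h7 := hd.card_odd_le
      refine le_trans ?_ (card_add_one_le_height hSP' hPS)
      exact_mod_cast (by omega)
  · have h4 := hd.card_add_card_le (S := S) (J := J) fun j hj => ⟨heven j hj, fun ho => by
      have := (Finset.mem_filter.1 hj).2
      rw [parameterSpace, if_neg (Nat.not_even_iff_odd.2 ho), Submodule.map_le_iff_le_comap] at this
      exact noMonomial_of_le hSP fun G hG => (hP.mem_or_mem (this hG)).resolve_left hFP⟩
    refine le_trans ?_ (card_le_height hSP')
    exact_mod_cast (by omega)

lemma X_mem_of_forall_le_height {q : Fin 4 → MvPolynomial (Fin 4) ℂ} {e : Fin 4 → ℕ}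
    (hq : ∀ j, IsWeightedHomogeneous basicDeg (q j) (e j))
    (h : ∀ P : Ideal (MvPolynomial (Fin 4) ℂ), P.IsPrime → (∀ j, q j ∈ P) → 4 ≤ P.height)
    {P : Ideal (MvPolynomial (Fin 4) ℂ)} (hP : P.IsPrime) (hqP : ∀ j, q j ∈ P) (i : Fin 4) :
    X i ∈ P := by
  let _ := weightedGradedAlgebra ℂ basicDeg
  set K := P.homogeneousCore (weightedHomogeneousSubmodule ℂ basicDeg) with hK
  have hKP : K.toIdeal.IsPrime := hP.homogeneousCore
  have h4 : 4 ≤ K.toIdeal.height := h _ hKP fun j =>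
    Ideal.mem_homogeneousCore_of_homogeneous_of_mem ⟨e j, hq j⟩ (hqP j)
  have hle : K.toIdeal ≤ varIdeal Finset.univ := fun f hf => by
    have h0 := weightedHomogeneousComponent_mem_of_mem ℂ basicDeg K.isHomogeneous hf 0
    rw [weightedHomogeneousComponent_zero _ (by intro i; fin_cases i <;> simp [basicDeg])] at h0
    have hc : coeff 0 f = 0 := by
      by_contra hc
      exact hKP.ne_top (Ideal.eq_top_of_isUnit_mem _ h0 ((isUnit_iff_ne_zero.2 hc).map C))
    rw [varIdeal, RingHom.mem_ker]
    simp only [Finset.mem_univ, if_true, aeval_zero', constantCoeff_eq, hc, map_zero]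
  have heq : K.toIdeal = varIdeal Finset.univ := by
    by_contra hne
    have h5 := Ideal.height_add_one_le_of_lt_of_isPrime (lt_of_le_of_ne hle hne)
    have h6 := ((add_le_add_left h4 1).trans h5).trans height_varIdeal_le
    rw [Fintype.card_fin] at h6
    exact absurd h6 (by decide)
  exact Ideal.toIdeal_homogeneousCore_le _ P
    (heq ▸ X_mem_varIdeal.2 (Finset.mem_univ i) : X i ∈ K.toIdeal)

lemma exists_mem_parameterSpace (hd : Admissible d) (hF : IsWeightedHomogeneous basicDeg F 30)
    (h2 : ∃ c, eval ![0, 0, c, 0] F ≠ 0) (h3 : ∃ c, eval ![0, 0, 0, c] F ≠ 0) :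
    ∃ q : Fin 4 → MvPolynomial (Fin 4) ℂ, (∀ j, q j ∈ parameterSpace F (d j)) ∧
      ∀ P : Ideal (MvPolynomial (Fin 4) ℂ), P.IsPrime → (∀ j, q j ∈ P) → ∀ i, X i ∈ P := by
  obtain ⟨q, hq, hP⟩ := exists_forall_card_le_height (fun j => parameterSpace F (d j))
    (card_parameterSpace_le_height hd h2 h3)
  have hq' : ∀ j, ∃ e, IsWeightedHomogeneous basicDeg (q j) e := fun j => by
    have := hq j
    rw [parameterSpace] at this
    split_ifs at this with he
    · exact ⟨_, this⟩
    · obtain ⟨G, hG, hGq⟩ := this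
      exact ⟨_, hGq.subst (motive := fun r => IsWeightedHomogeneous basicDeg r _) (hF.mul hG)⟩
  choose e he using hq'
  exact ⟨q, hq, fun P hPp hqP => X_mem_of_forall_le_height he hP hPp hqP⟩

end Parameters

section FiniteOverParameters

variable {σ κ : Type*} {w : σ → ℕ}
  {g : κ → MvPolynomial σ ℂ} {e : κ → ℕ}

lemma weightedHomogeneousComponent_mul_mem
    {M : Submodule (Algebra.adjoin ℂ (Set.range g)) (MvPolynomial σ ℂ)} {n : ℕ}
    (hM : ∀ m : σ →₀ ℕ, Finsupp.weight w m < n → monomial m 1 ∈ M) {j : κ}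
    (hg : IsWeightedHomogeneous w (g j) (e j)) (he : 0 < e j) (c : MvPolynomial σ ℂ) :
    weightedHomogeneousComponent w n (c * g j) ∈ M := by
  induction c using MvPolynomial.induction_on' with
  | add p q hp hq => rw [add_mul, map_add]; exact M.add_mem hp hq
  | monomial m a =>
    have hh : IsWeightedHomogeneous w (monomial m a * g j) (Finsupp.weight w m + e j) :=
      (isWeightedHomogeneous_monomial _ _ _ rfl).mul hg
    by_cases hn : Finsupp.weight w m + e j = n
    · rw [← hn, hh.weightedHomogeneousComponent_same]
      have h1 := M.smul_mem (algebraMap ℂ (Algebra.adjoin ℂ (Set.range g)) a *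
        ⟨g j, Algebra.subset_adjoin ⟨j, rfl⟩⟩) (hM m (by omega))
      convert h1 using 1
      rw [Algebra.smul_def, map_mul, ← IsScalarTower.algebraMap_apply, algebraMap_eq,
        mul_right_comm, C_mul_monomial, mul_one]
      rfl
    · rw [hh.weightedHomogeneousComponent_ne _ (Ne.symm hn)]
      exact M.zero_mem

lemma finite_adjoin_of_X_mem [Fintype σ] [Fintype κ]
    (hg : ∀ j, IsWeightedHomogeneous w (g j) (e j)) (he : ∀ j, 0 < e j)
    (h : ∀ P : Ideal (MvPolynomial σ ℂ), P.IsPrime → (∀ j, g j ∈ P) → ∀ i, X i ∈ P) :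
    Module.Finite (Algebra.adjoin ℂ (Set.range g)) (MvPolynomial σ ℂ) := by
  classical
  have hrad : ∀ i, X i ∈ (Ideal.span (Set.range g)).radical := fun i => by
    rw [Ideal.radical_eq_sInf, Ideal.mem_sInf]
    exact fun {P} hP => h P hP.2 (fun j => hP.1 (Ideal.subset_span ⟨j, rfl⟩)) i
  choose N hN using hrad
  set B : Set (σ →₀ ℕ) := Set.Icc 0 (Finsupp.equivFunOnFinite.symm N) with hB
  set M : Submodule (Algebra.adjoin ℂ (Set.range g)) (MvPolynomial σ ℂ) :=
    Submodule.span _ ((fun m => monomial m 1) '' B) with hM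
  have key : ∀ n, ∀ m : σ →₀ ℕ, Finsupp.weight w m = n → monomial m 1 ∈ M := by
    intro n
    induction n using Nat.strong_induction_on with
    | _ n ih =>
      intro m hm
      by_cases hmB : m ∈ B
      · exact Submodule.subset_span ⟨m, hmB, rfl⟩
      · obtain ⟨i, hi⟩ : ∃ i, N i ≤ m i := by
          by_contra! hlt
          exact hmB ⟨zero_le, fun i => (hlt i).le⟩
        have hmem : monomial m 1 ∈ Ideal.span (Set.range g) := by
          rw [← tsub_add_cancel_of_le (Finsupp.single_le_iff.2 hi : Finsupp.single i (N i) ≤ m),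
            ← one_mul (1 : ℂ), ← monomial_mul, ← X_pow_eq_monomial]
          exact Ideal.mul_mem_left _ _ (hN i)
        obtain ⟨c, hc⟩ := Ideal.mem_span_range_iff_exists_fun.1 hmem
        rw [← (isWeightedHomogeneous_monomial w m (1 : ℂ) hm).weightedHomogeneousComponent_same,
          ← hc, map_sum]
        exact M.sum_mem fun j _ => weightedHomogeneousComponent_mul_mem
          (fun m' hm' => ih _ hm' m' rfl) (hg j) (he j) (c j)
  refine ⟨⟨((Set.finite_Icc (0 : σ →₀ ℕ) (Finsupp.equivFunOnFinite.symm N)).image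
    fun m => (monomial m (1 : ℂ))).toFinset, ?_⟩⟩
  rw [Set.Finite.coe_toFinset, Submodule.eq_top_iff']
  intro p
  induction p using MvPolynomial.induction_on' with
  | add p q hp hq => exact Submodule.add_mem _ hp hq
  | monomial m a =>
    have := M.smul_mem (algebraMap ℂ (Algebra.adjoin ℂ (Set.range g)) a) (key _ m rfl)
    rwa [algebraMap_smul, smul_monomial, smul_eq_mul, mul_one] at this

lemma integralOver_X [Fintype σ] [Fintype κ]
    (hg : ∀ j, IsWeightedHomogeneous w (g j) (e j)) (he : ∀ j, 0 < e j)
    (h : ∀ P : Ideal (MvPolynomial σ ℂ), P.IsPrime → (∀ j, g j ∈ P) → ∀ i, X i ∈ P) (i : σ) :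
    IntegralOver g (X i) := by
  have := finite_adjoin_of_X_mem hg he h
  exact IsIntegral.of_finite _ _

end FiniteOverParameters

section Construction

variable {d : Fin 4 → ℕ} {F : MvPolynomial (Fin 4) ℂ}

/-- `evenMap` with values in the ring of invariants. -/
def evenMap' : MvPolynomial (Fin 4) ℂ →ₐ[ℂ] invariantRing 6 :=
  evenMap.codRestrict _ evenMap_mem

lemma coe_evenMap' (G : MvPolynomial (Fin 4) ℂ) :
    (evenMap' G : MvPolynomial (Fin 7) ℂ) = evenMap G :=
  rfl

/-- The basic invariant of degree `15`, as an element of the ring of invariants. -/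
def oddInv' : invariantRing 6 := ⟨oddInv X, oddInv_mem⟩

lemma exists_eq_evenMap'_add (p : invariantRing 6) :
    ∃ G H, p = evenMap' G + oddInv' * evenMap' H := by
  obtain ⟨G, H, h⟩ := exists_evenMap_add p.2
  exact ⟨G, H, Subtype.ext h⟩

lemma integralOver_evenMap' {p : Fin 4 → invariantRing 6}
    (hp : ∀ i, IntegralOver p (evenMap' (X i))) (G : MvPolynomial (Fin 4) ℂ) :
    IntegralOver p (evenMap' G) := by
  induction G using MvPolynomial.induction_on with
  | C a =>
    rw [← algebraMap_eq, AlgHom.commutes]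
    exact isIntegral_algebraMap (x := algebraMap ℂ (Algebra.adjoin ℂ (Set.range p)) a)
  | add G H hG hH => rw [map_add]; exact IsIntegral.add hG hH
  | mul_X G i hG => rw [map_mul]; exact IsIntegral.mul hG (hp i)

lemma finite_adjoin_of_integralOver {p : Fin 4 → invariantRing 6}
    (he : ∀ G, IntegralOver p (evenMap' G)) (ho : IntegralOver p oddInv') :
    Module.Finite (Algebra.adjoin ℂ (Set.range p)) (invariantRing 6) := by
  have h_int : Algebra.IsIntegral (Algebra.adjoin ℂ (Set.range p)) (invariantRing 6) := ⟨fun x => by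
    obtain ⟨G, H, rfl⟩ := exists_eq_evenMap'_add x
    exact IsIntegral.add (he G) (IsIntegral.mul ho (he H))⟩
  have hft : Algebra.FiniteType ℂ (invariantRing 6) := by
    refine ⟨⟨insert oddInv' (Finset.univ.image fun i => evenMap' (X i)), ?_⟩⟩
    rw [eq_top_iff]
    intro x _
    obtain ⟨G, H, rfl⟩ := exists_eq_evenMap'_add x
    have hG : ∀ G, evenMap' G ∈ Algebra.adjoin ℂ
        (↑(insert oddInv' (Finset.univ.image fun i => evenMap' (X i))) : Set (invariantRing 6)) :=
      fun G => by
        induction G using MvPolynomial.induction_on with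
        | C a => rw [← algebraMap_eq, AlgHom.commutes]; exact Subalgebra.algebraMap_mem _ a
        | add G H hG hH => rw [map_add]; exact add_mem hG hH
        | mul_X G i hG =>
          rw [map_mul]
          exact mul_mem hG (Algebra.subset_adjoin (by simp))
    exact add_mem (hG G) (mul_mem (Algebra.subset_adjoin (by simp)) (hG H))
  have : Algebra.FiniteType (Algebra.adjoin ℂ (Set.range p)) (invariantRing 6) :=
    .of_restrictScalars_finiteType ℂ _ _
  exact Algebra.IsIntegral.finite (R := Algebra.adjoin ℂ (Set.range p)) (A := invariantRing 6)

lemma algebraicIndependent_of_finite {p : Fin 4 → invariantRing 6}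
    (hp : Module.Finite (Algebra.adjoin ℂ (Set.range p)) (invariantRing 6)) :
    AlgebraicIndependent ℂ p := by
  have hind : AlgebraicIndependent ℂ fun i : Fin 4 => evenMap' (X i) := by
    refine AlgebraicIndependent.of_comp (invariantRing 6).val ?_
    simpa [Function.comp_def, coe_evenMap', evenMap] using algebraicIndependent_evenInv
  have h_int : Algebra.IsIntegral (Algebra.adjoin ℂ (Set.range p)) (invariantRing 6) :=
    Algebra.IsIntegral.of_finite _ _
  have halg : Algebra.IsAlgebraic (Algebra.adjoin ℂ (Set.range p)) (invariantRing 6) :=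
    inferInstance
  exact (Algebra.IsAlgebraic.isTranscendenceBasis_of_lift_le_trdeg_of_finite ℂ p
    hind.lift_cardinalMk_le_trdeg).1

lemma exists_invariant_of_mem {n : ℕ} (hn : 0 < n) (h15 : Odd n → 15 ≤ n)
    (hF : IsWeightedHomogeneous basicDeg F 30) (hFo : evenMap F = oddInv X ^ 2)
    {q : MvPolynomial (Fin 4) ℂ} (hq : q ∈ parameterSpace F n) :
    ∃ (p : invariantRing 6) (g : MvPolynomial (Fin 4) ℂ) (e m : ℕ),
      (p : MvPolynomial (Fin 7) ℂ).IsHomogeneous n ∧ IsWeightedHomogeneous basicDeg g e ∧ 0 < e ∧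
      evenMap' g = p ^ m ∧
      ∀ P : Ideal (MvPolynomial (Fin 4) ℂ), P.IsPrime → g ∈ P → q ∈ P := by
  rw [parameterSpace] at hq
  split_ifs at hq with he
  · exact ⟨evenMap' q, q, n, 1, isHomogeneous_evenMap hq, hq, hn, (pow_one _).symm,
      fun _ _ h => h⟩
  · obtain ⟨G, hG, rfl⟩ := hq
    have hn15 := h15 (Nat.not_even_iff_odd.1 he)
    refine ⟨oddInv' * evenMap' G, F * G ^ 2, 30 + 2 * (n - 15), 2, ?_, hF.mul (hG.pow 2), by omega,
      ?_, fun P hP h => ?_⟩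
    · have := isHomogeneous_oddInv.mul (isHomogeneous_evenMap hG)
      rwa [show 15 + (n - 15) = n by omega] at this
    · refine Subtype.ext ?_
      change evenMap (F * G ^ 2) = (oddInv X * evenMap G) ^ 2
      rw [map_mul, map_pow, hFo, mul_pow]
    · rcases hP.mem_or_mem h with h | h
      · exact P.mul_mem_right _ h
      · exact P.mul_mem_left _ (hP.mem_of_pow_mem 2 h)

theorem exists_isHSOP (hd : Admissible d) (hpos : ∀ k, 0 < d k) :
    ∃ p : Fin 4 → invariantRing 6, IsHSOP 6 d p := by
  obtain ⟨F, hF, hFo, h2, h3⟩ := exists_evenMap_eq_oddInv_sq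
  obtain ⟨q, hq, hX⟩ := exists_mem_parameterSpace hd hF h2 h3
  choose p g e m hp hg he hgp hgq using fun j =>
    exists_invariant_of_mem (hpos j) hd.fifteen_le hF hFo (hq j)
  have hpp : ∀ j, IntegralOver p (p j) := fun j =>
    isIntegral_algebraMap
      (x := (⟨p j, Algebra.subset_adjoin ⟨j, rfl⟩⟩ : Algebra.adjoin ℂ (Set.range p)))
  have hpX : ∀ i, IntegralOver p (evenMap' (X i)) := fun i =>
    ((integralOver_X hg he (fun P hP h => hX P hP fun j => hgq j P hP (h j)) i).map evenMap').trans
      fun j => by rw [hgp]; exact IsIntegral.pow (hpp j) _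
  have ho : IntegralOver p oddInv' := by
    have h : oddInv' ^ 2 = evenMap' F := Subtype.ext hFo.symm
    refine IsIntegral.of_pow two_pos ?_
    rw [h]
    exact integralOver_evenMap' hpX F
  have hfin := finite_adjoin_of_integralOver (integralOver_evenMap' hpX) ho
  exact ⟨p, hpos, hp, algebraicIndependent_of_finite hfin, hfin⟩

end Construction

end BinarySextic

theorem stmt_14 (d : Fin 4 → ℕ) (hd : ∀ k, 0 < d k) :
    (∃ p : Fin (6-2) → invariantRing 6, IsHSOP 6 d p) ↔
      ((∀ k, d k ∉ ({1, 3, 5, 7, 9, 11, 13} : Set ℕ)) ∧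
       (Finset.univ.filter fun k => d k ∈ ({2, 17} : Finset ℕ)).card ≤ 1 ∧
       (Finset.univ.filter fun k =>
          d k ∈ ({2, 4, 8, 14, 17, 19, 23, 29} : Finset ℕ)).card ≤ 2 ∧
       (Finset.univ.filter fun k => d k ∈ ({2, 6, 17, 21} : Finset ℕ)).card ≤ 2 ∧
       3 ≤ (Finset.univ.filter fun k => 2 ∣ d k).card ∧
       (∃ k, 3 ∣ d k) ∧ (∃ k, 4 ∣ d k) ∧ (∃ k, 5 ∣ d k)) :=
  ⟨fun ⟨_, h⟩ => BinarySextic.admissible_of_isHSOP h, fun h => BinarySextic.exists_isHSOP h hd⟩
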